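/- Assume the inverse temperature sequence (β_N)_{N≥1} with β_N ∈ (0,1) satisfies lim_{N→∞} β_N = 1 and lim_{N→∞} N^{1/3}(1 − β_N²) = c where c ∈ (0,∞) or c = ∞. Then for each integer k ≥ 1, sup_N E⟨(N·(1 − β_N²)·R(σ¹,σ²)²)^k⟩ < ∞, where the Gibbs average is taken at inverse temperature β_N. -/

import Mathlib

open MeasureTheory ProbabilityTheory Real Finset Filter

noncomputable section

/-- Spin configurations: each of the `N` sites carries a `±1` spin, encoded by a `Bool`. -/
abbrev Config (N : ℕ) := Fin N → Bool

/-- The `±1` value of a spin. -/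
def spin (b : Bool) : ℝ := if b then 1 else -1

/-- The value of the last spin `σ_N` (junk value `0` when `N = 0`). -/
def spinLast {N : ℕ} (σ : Config N) : ℝ :=
  if h : 0 < N then spin (σ ⟨N - 1, Nat.sub_lt h Nat.one_pos⟩) else 0

/-- The Gaussian disorder: i.i.d. standard Gaussians indexed by pairs `(i, j)`
(only the entries with `i < j` are used). -/
def gaussPi (N : ℕ) : Measure (Fin N × Fin N → ℝ) :=
  Measure.pi fun _ => gaussianReal 0 1

instance (N : ℕ) : IsProbabilityMeasure (gaussPi N) := by
  unfold gaussPi; infer_instance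

/-- Three independent copies `g, g', g''` of the disorder. -/
def disM3 (N : ℕ) :
    Measure ((Fin N × Fin N → ℝ) × (Fin N × Fin N → ℝ) × (Fin N × Fin N → ℝ)) :=
  (gaussPi N).prod ((gaussPi N).prod (gaussPi N))

/-- The SK Hamiltonian `H_{N,β}(σ) = (β/√N) ∑_{i<j} g_{ij} σ_i σ_j`. -/
def ham (N : ℕ) (β : ℝ) (g : Fin N × Fin N → ℝ) (σ : Config N) : ℝ :=
  (β / Real.sqrt N) *
    ∑ p ∈ Finset.univ.filter (fun p : Fin N × Fin N => p.1 < p.2),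
      g p * spin (σ p.1) * spin (σ p.2)

/-- The cavity Hamiltonian `H⁻_N(σ) = (β/√N) ∑_{i<j<N} g_{ij} σ_i σ_j` on the first
`N - 1` spins. -/
def hamCav (N : ℕ) (β : ℝ) (g : Fin N × Fin N → ℝ) (σ : Config N) : ℝ :=
  (β / Real.sqrt N) *
    ∑ p ∈ Finset.univ.filter
        (fun p : Fin N × Fin N => p.1 < p.2 ∧ (p.2 : ℕ) < N - 1),
      g p * spin (σ p.1) * spin (σ p.2)

/-- The overlap `R(σ¹,σ²) = (1/N) ∑_{i ≤ N} σ_i¹ σ_i²`. -/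
def ovlp (N : ℕ) (σ τ : Config N) : ℝ := (∑ i, spin (σ i) * spin (τ i)) / N

/-- The truncated overlap `R⁻(σ¹,σ²) = (1/N) ∑_{i ≤ N−1} σ_i¹ σ_i²`. -/
def ovlpm (N : ℕ) (σ τ : Config N) : ℝ :=
  (∑ i ∈ Finset.univ.filter (fun i : Fin N => (i : ℕ) < N - 1),
    spin (σ i) * spin (τ i)) / N

/-- The partition function `Z_N(β)`. -/
def partFun (N : ℕ) (β : ℝ) (g : Fin N × Fin N → ℝ) : ℝ :=
  ∑ σ : Config N, Real.exp (ham N β g σ)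

/-- The free energy `F_N(β) = ln Z_N(β)`. -/
def freeEnergy (N : ℕ) (β : ℝ) (g : Fin N × Fin N → ℝ) : ℝ :=
  Real.log (partFun N β g)

/-- Two-replica Gibbs average `⟨f⟩` for the single SK system. -/
def gibbs2 (N : ℕ) (β : ℝ) (g : Fin N × Fin N → ℝ)
    (f : Config N → Config N → ℝ) : ℝ :=
  (∑ σ : Config N, ∑ τ : Config N,
    f σ τ * Real.exp (ham N β g σ + ham N β g τ)) / (partFun N β g) ^ 2

/-- Disorder expectation of the two-replica Gibbs average. -/
def Egibbs2 (N : ℕ) (β : ℝ) (f : Config N → Config N → ℝ) : ℝ :=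
  ∫ g, gibbs2 N β g f ∂gaussPi N

/-- The interpolated Hamiltonian `√t · H_N + √(1−t) · H'_N`. -/
def hamT (N : ℕ) (β t : ℝ) (g g' : Fin N × Fin N → ℝ) (σ : Config N) : ℝ :=
  Real.sqrt t * ham N β g σ + Real.sqrt (1 - t) * ham N β g' σ

/-- The coupled Gibbs weight `exp(H¹_{N,t}(σ) + H²_{N,t}(τ))`. -/
def wT (N : ℕ) (β t : ℝ) (g g' g'' : Fin N × Fin N → ℝ)
    (ρ : Config N × Config N) : ℝ :=
  Real.exp (hamT N β t g g' ρ.1 + hamT N β t g g'' ρ.2)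

/-- The coupled Gibbs average `⟨f⟩_t` of a function of one pair `(σ, τ)`. -/
def gibbsT (N : ℕ) (β t : ℝ) (g g' g'' : Fin N × Fin N → ℝ)
    (f : Config N × Config N → ℝ) : ℝ :=
  (∑ ρ : Config N × Config N, f ρ * wT N β t g g' g'' ρ) /
    (∑ ρ : Config N × Config N, wT N β t g g' g'' ρ)

/-- The coupled Gibbs average `⟨f⟩_t` of a function of two pairs. -/
def gibbsT2 (N : ℕ) (β t : ℝ) (g g' g'' : Fin N × Fin N → ℝ)
    (f : Config N × Config N → Config N × Config N → ℝ) : ℝ :=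
  (∑ ρ₁ : Config N × Config N, ∑ ρ₂ : Config N × Config N,
    f ρ₁ ρ₂ * wT N β t g g' g'' ρ₁ * wT N β t g g' g'' ρ₂) /
    (∑ ρ : Config N × Config N, wT N β t g g' g'' ρ) ^ 2

/-- Disorder expectation `E⟨f⟩_t` (one pair). -/
def EgibbsT (N : ℕ) (β t : ℝ) (f : Config N × Config N → ℝ) : ℝ :=
  ∫ ω, gibbsT N β t ω.1 ω.2.1 ω.2.2 f ∂disM3 N

/-- Disorder expectation `E⟨f⟩_t` (two pairs). -/
def EgibbsT2 (N : ℕ) (β t : ℝ)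
    (f : Config N × Config N → Config N × Config N → ℝ) : ℝ :=
  ∫ ω, gibbsT2 N β t ω.1 ω.2.1 ω.2.2 f ∂disM3 N

/-- The `s`-dependent cavity field term
`(β/√N) σ_N ∑_{i<N} (√t g_{iN} + √(1−t) g'_{iN}) σ_i`. -/
def cavField (N : ℕ) (β t : ℝ) (g g' : Fin N × Fin N → ℝ) (σ : Config N) : ℝ :=
  if h : 0 < N then
    (β / Real.sqrt N) * spin (σ ⟨N - 1, Nat.sub_lt h Nat.one_pos⟩) *
      ∑ i ∈ Finset.univ.filter (fun i : Fin N => (i : ℕ) < N - 1),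
        (Real.sqrt t * g (i, ⟨N - 1, Nat.sub_lt h Nat.one_pos⟩) +
          Real.sqrt (1 - t) * g' (i, ⟨N - 1, Nat.sub_lt h Nat.one_pos⟩)) * spin (σ i)
  else 0

/-- The cavity-interpolated Hamiltonian `H^1_{N,t,s}` (resp. `H^2_{N,t,s}` with `g''`). -/
def hamTS (N : ℕ) (β t s : ℝ) (g g' : Fin N × Fin N → ℝ) (σ : Config N) : ℝ :=
  Real.sqrt t * hamCav N β g σ + Real.sqrt (1 - t) * hamCav N β g' σ +
    Real.sqrt s * cavField N β t g g' σ

/-- The coupled cavity Gibbs weight `exp(H¹_{N,t,s}(σ) + H²_{N,t,s}(τ))`. -/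
def wTS (N : ℕ) (β t s : ℝ) (g g' g'' : Fin N × Fin N → ℝ)
    (ρ : Config N × Config N) : ℝ :=
  Real.exp (hamTS N β t s g g' ρ.1 + hamTS N β t s g g'' ρ.2)

/-- The coupled cavity Gibbs average `⟨f⟩_{t,s}` of a function of one pair. -/
def gibbsTS1 (N : ℕ) (β t s : ℝ) (g g' g'' : Fin N × Fin N → ℝ)
    (f : Config N × Config N → ℝ) : ℝ :=
  (∑ ρ : Config N × Config N, f ρ * wTS N β t s g g' g'' ρ) /
    (∑ ρ : Config N × Config N, wTS N β t s g g' g'' ρ)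

/-- The coupled cavity Gibbs average `⟨f⟩_{t,s}` of a function of two pairs. -/
def gibbsTS2 (N : ℕ) (β t s : ℝ) (g g' g'' : Fin N × Fin N → ℝ)
    (f : Config N × Config N → Config N × Config N → ℝ) : ℝ :=
  (∑ ρ₁ : Config N × Config N, ∑ ρ₂ : Config N × Config N,
    f ρ₁ ρ₂ * wTS N β t s g g' g'' ρ₁ * wTS N β t s g g' g'' ρ₂) /
    (∑ ρ : Config N × Config N, wTS N β t s g g' g'' ρ) ^ 2

/-- The coupled cavity Gibbs average `⟨f⟩_{t,s}` of a function of `n` pairs. -/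
def gibbsTSn (N : ℕ) (β t s : ℝ) (g g' g'' : Fin N × Fin N → ℝ) {n : ℕ}
    (f : (Fin n → Config N × Config N) → ℝ) : ℝ :=
  (∑ ρ : Fin n → Config N × Config N, f ρ * ∏ l, wTS N β t s g g' g'' (ρ l)) /
    (∑ ρ₀ : Config N × Config N, wTS N β t s g g' g'' ρ₀) ^ n

/-- Disorder expectation `E⟨f⟩_{t,s}` (one pair). -/
def EgibbsTS1 (N : ℕ) (β t s : ℝ) (f : Config N × Config N → ℝ) : ℝ :=
  ∫ ω, gibbsTS1 N β t s ω.1 ω.2.1 ω.2.2 f ∂disM3 N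

/-- Disorder expectation `E⟨f⟩_{t,s}` (two pairs). -/
def EgibbsTS2 (N : ℕ) (β t s : ℝ)
    (f : Config N × Config N → Config N × Config N → ℝ) : ℝ :=
  ∫ ω, gibbsTS2 N β t s ω.1 ω.2.1 ω.2.2 f ∂disM3 N

/-- Disorder expectation `E⟨f⟩_{t,s}` (`n` pairs). -/
def EgibbsTSn (N : ℕ) (β t s : ℝ) {n : ℕ}
    (f : (Fin n → Config N × Config N) → ℝ) : ℝ :=
  ∫ ω, gibbsTSn N β t s ω.1 ω.2.1 ω.2.2 f ∂disM3 N

/-- The covariance kernel `U(ρ, ρ')` of the `s`-part of the coupled cavity Hamiltonians. -/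
def Ufun (N : ℕ) (β t : ℝ) (ρ ρ' : Config N × Config N) : ℝ :=
  β ^ 2 / 2 * (spinLast ρ.1 * spinLast ρ'.1 * ovlpm N ρ.1 ρ'.1 +
      spinLast ρ.2 * spinLast ρ'.2 * ovlpm N ρ.2 ρ'.2) +
    β ^ 2 * t / 2 * (spinLast ρ.1 * spinLast ρ'.2 * ovlpm N ρ.1 ρ'.2 +
      spinLast ρ.2 * spinLast ρ'.1 * ovlpm N ρ.2 ρ'.1)

/-- `ν(β) = −(1/2)·ln(1 − β²) − β²/2`. -/
def nuSK (b : ℝ) : ℝ := -(1 / 2) * Real.log (1 - b ^ 2) - b ^ 2 / 2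

/-! ### Gaussian integration by parts -/

/-- Stein's identity for the standard Gaussian law on the line. -/
theorem integral_mul_gaussianReal_eq_integral_deriv {f f' : ℝ → ℝ} {C D : ℝ}
    (hf : ∀ x, HasDerivAt f (f' x) x) (hC : ∀ x, |f x| ≤ C) (hD : ∀ x, |f' x| ≤ D) :
    ∫ x, x * f x ∂gaussianReal 0 1 = ∫ x, f' x ∂gaussianReal 0 1 := by
  rw [integral_gaussianReal_eq_integral_smul one_ne_zero,
    integral_gaussianReal_eq_integral_smul one_ne_zero]
  have hcont : Continuous f := continuous_iff_continuousAt.2 fun x => (hf x).continuousAt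
  have hmeas' : Measurable f' := by
    have : f' = deriv f := funext fun x => ((hf x).deriv).symm
    rw [this]; exact measurable_deriv f
  have hpdf : ∀ x, HasDerivAt (gaussianPDFReal 0 1) (-(x * gaussianPDFReal 0 1 x)) x := by
    intro x
    have h1 : HasDerivAt (fun x : ℝ => -(x - 0) ^ 2 / (2 * ((1 : NNReal) : ℝ))) (-x) x := by
      refine ((((hasDerivAt_id' x).sub_const (0 : ℝ)).fun_pow 2).fun_neg.div_const
        (2 * ((1 : NNReal) : ℝ))).congr_deriv ?_
      simp only [NNReal.coe_one]
      ring
    rw [gaussianPDFReal_def]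
    exact ((h1.exp).const_mul ((√(2 * π * ((1 : NNReal) : ℝ)))⁻¹)).congr_deriv (by ring)
  have hint : Integrable (gaussianPDFReal 0 1) := integrable_gaussianPDFReal 0 1
  have hidint : Integrable fun x => x * gaussianPDFReal 0 1 x := by
    have h : Integrable (fun x : ℝ => x) (gaussianReal 0 1) :=
      (memLp_id_gaussianReal (μ := 0) (v := 1) 1).integrable (by simp)
    rw [gaussianReal_of_var_ne_zero 0 one_ne_zero] at h
    have h2 := (integrable_withDensity_iff_integrable_smul' (measurable_gaussianPDF 0 1)
      (by simp [gaussianPDF])).1 h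
    refine h2.congr (Eventually.of_forall fun x => ?_)
    simp [toReal_gaussianPDF, mul_comm]
  have key := integral_mul_deriv_eq_deriv_mul_of_integrable (u := f) (u' := f')
    (v := gaussianPDFReal 0 1) (v' := fun x => -(x * gaussianPDFReal 0 1 x))
    (fun x _ => hf x) (fun x _ => hpdf x)
    (hidint.neg.bdd_mul (c := C) hcont.aestronglyMeasurable (Eventually.of_forall hC))
    (hint.bdd_mul (c := D) hmeas'.aestronglyMeasurable (Eventually.of_forall hD))
    (hint.bdd_mul (c := C) hcont.aestronglyMeasurable (Eventually.of_forall hC))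
  have h3 : ∫ x, gaussianPDFReal 0 1 x • (x * f x)
      = -∫ x, f x * -(x * gaussianPDFReal 0 1 x) := by
    rw [← integral_neg]
    refine integral_congr_ae (Eventually.of_forall fun x => ?_)
    simp only [smul_eq_mul]; ring
  rw [h3, key, neg_neg]
  refine integral_congr_ae (Eventually.of_forall fun x => ?_)
  simp only [smul_eq_mul]; ring

section GaussianProduct

variable {P : Type*} [Fintype P]

/-- The standard Gaussian product measure on `P → ℝ`. -/
abbrev gaussProd (P : Type*) [Fintype P] : Measure (P → ℝ) :=
  Measure.pi fun _ => gaussianReal 0 1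

/-- Resampling one coordinate preserves the product measure. -/
theorem measurePreserving_update [DecidableEq P] (p : P) :
    MeasurePreserving (fun z : ℝ × (P → ℝ) => Function.update z.2 p z.1)
      ((gaussianReal 0 1).prod (gaussProd P)) (gaussProd P) := by
  have hm : Measurable (fun z : ℝ × (P → ℝ) => Function.update z.2 p z.1) := by
    refine measurable_pi_iff.2 fun q => ?_
    by_cases h : q = p
    · subst h; simpa using measurable_fst
    · simp only [Function.update_of_ne h]; fun_prop
  refine ⟨hm, (Measure.pi_eq fun s hs => ?_).symm⟩
  rw [Measure.map_apply hm (MeasurableSet.univ_pi hs)]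
  have : (fun z : ℝ × (P → ℝ) => Function.update z.2 p z.1) ⁻¹' (Set.univ.pi s)
      = s p ×ˢ (Set.univ.pi (Function.update s p Set.univ)) := by
    ext z
    simp only [Set.mem_preimage, Set.mem_univ_pi, Set.mem_prod]
    constructor
    · intro h
      refine ⟨by simpa using h p, fun q => ?_⟩
      by_cases hq : q = p
      · subst hq; simp
      · simpa [Function.update_of_ne hq] using h q
    · rintro ⟨h1, h2⟩ q
      by_cases hq : q = p
      · subst hq; simpa using h1
      · simpa [Function.update_of_ne hq] using h2 q
  rw [this, Measure.prod_prod, Measure.pi_pi, ← Finset.mul_prod_erase Finset.univ _ (mem_univ p),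
    ← Finset.mul_prod_erase Finset.univ (fun i => gaussianReal 0 1 (s i)) (mem_univ p)]
  simp only [Function.update_self, measure_univ, one_mul]
  congr 1
  refine Finset.prod_congr rfl fun q hq => ?_
  rw [Function.update_of_ne (Finset.ne_of_mem_erase hq)]

theorem integrable_eval_gaussProd (p : P) : Integrable (fun g : P → ℝ => g p) (gaussProd P) :=
  integrable_eval (μ := fun _ : P => gaussianReal 0 1) (i := p)
    ((memLp_id_gaussianReal (μ := 0) (v := 1) 1).integrable (by simp))

/-- Gaussian integration by parts in one coordinate. -/
theorem integral_coord_mul_eq_integral_deriv [DecidableEq P] (p : P) {f f' : (P → ℝ) → ℝ}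
    {C D : ℝ} (hfm : Measurable f) (hfm' : Measurable f')
    (hf : ∀ g x, HasDerivAt (fun t => f (Function.update g p t)) (f' (Function.update g p x)) x)
    (hC : ∀ g, |f g| ≤ C) (hD : ∀ g, |f' g| ≤ D) :
    ∫ g, g p * f g ∂gaussProd P = ∫ g, f' g ∂gaussProd P := by
  have hmp := measurePreserving_update p
  have hi1 : Integrable (fun g => g p * f g) (gaussProd P) :=
    (integrable_eval_gaussProd p).mul_bdd (c := C) hfm.aestronglyMeasurable
      (Eventually.of_forall hC)
  have hi2 : Integrable f' (gaussProd P) :=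
    Integrable.of_bound hfm'.aestronglyMeasurable D (Eventually.of_forall hD)
  rw [← hmp.map_eq, integral_map hmp.measurable.aemeasurable
      (by rw [hmp.map_eq]; exact hi1.aestronglyMeasurable),
    integral_map hmp.measurable.aemeasurable (by rw [hmp.map_eq]; exact hi2.aestronglyMeasurable)]
  have hi1' : Integrable (fun z : ℝ × (P → ℝ) => Function.update z.2 p z.1 p *
      f (Function.update z.2 p z.1)) ((gaussianReal 0 1).prod (gaussProd P)) :=
    (hmp.integrable_comp hi1.aestronglyMeasurable).2 hi1
  have hi2' : Integrable (fun z : ℝ × (P → ℝ) => f' (Function.update z.2 p z.1))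
      ((gaussianReal 0 1).prod (gaussProd P)) :=
    (hmp.integrable_comp hi2.aestronglyMeasurable).2 hi2
  rw [integral_prod_symm _ hi1', integral_prod_symm _ hi2']
  refine integral_congr_ae (Eventually.of_forall fun g => ?_)
  simp only [Function.update_self]
  exact integral_mul_gaussianReal_eq_integral_deriv (hf g) (fun x => hC _) (fun x => hD _)

theorem integral_exp_linear_gaussProd (a : P → ℝ) :
    ∫ g, exp (∑ p, g p * a p) ∂gaussProd P = exp ((∑ p, a p ^ 2) / 2) := by
  simp_rw [exp_sum]
  rw [integral_fintype_prod_eq_prod (fun p x => exp (x * a p)), Finset.sum_div, exp_sum]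
  refine Finset.prod_congr rfl fun p _ => ?_
  have := mgf_gaussianReal (p := gaussianReal 0 1) (X := id) (μ := 0) (v := 1) (by simp) (a p)
  simp only [mgf, id_eq] at this
  simp_rw [mul_comm _ (a p)]
  rw [this]; simp

theorem integrable_exp_linear_gaussProd (a : P → ℝ) :
    Integrable (fun g : P → ℝ => exp (∑ p, g p * a p)) (gaussProd P) := by
  simp_rw [exp_sum]
  refine Integrable.fintype_prod (f := fun p x => exp (x * a p)) fun p => ?_
  simp_rw [mul_comm _ (a p)]
  exact integrable_exp_mul_gaussianReal (a p)

end GaussianProduct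

/-! ### Gaussian concentration -/

section Concentration

open scoped ENNReal

theorem absolutelyContinuous_pi_fin {μ ν : Measure ℝ} [SigmaFinite μ] [SigmaFinite ν]
    (h : μ ≪ ν) (n : ℕ) :
    (Measure.pi fun _ : Fin n => μ) ≪ Measure.pi fun _ : Fin n => ν := by
  induction n with
  | zero =>
    rw [Measure.pi_of_empty (fun _ => μ), Measure.pi_of_empty (fun _ => ν)]
  | succ n ih =>
    have h1 := measurePreserving_piFinSuccAbove (fun _ : Fin (n + 1) => μ) 0
    have h2 := measurePreserving_piFinSuccAbove (fun _ : Fin (n + 1) => ν) 0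
    rw [← (h1.symm _).map_eq, ← (h2.symm _).map_eq]
    exact (h.prod ih).map (MeasurableEquiv.measurable _)

variable {E : Type*} [NormedAddCommGroup E] [InnerProductSpace ℝ E] [FiniteDimensional ℝ E]
  [MeasurableSpace E] [BorelSpace E]

theorem stdGaussian_absolutelyContinuous : stdGaussian E ≪ (volume : Measure E) := by
  have h := absolutelyContinuous_pi_fin (gaussianReal_absolutelyContinuous 0 one_ne_zero)
    (Module.finrank ℝ E)
  have hm : MeasurePreserving (fun x : Fin (Module.finrank ℝ E) → ℝ =>
      ∑ i, x i • stdOrthonormalBasis ℝ E i) := by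
    have h1 := ((stdOrthonormalBasis ℝ E).measurePreserving_repr_symm).comp
      (PiLp.volume_preserving_toLp (Fin (Module.finrank ℝ E)))
    have h2 : (fun x : Fin (Module.finrank ℝ E) → ℝ => ∑ i, x i • stdOrthonormalBasis ℝ E i)
        = (stdOrthonormalBasis ℝ E).repr.symm ∘ WithLp.toLp 2 := by
      funext x
      exact (stdOrthonormalBasis ℝ E).sum_repr_symm (WithLp.toLp 2 x)
    rw [h2]
    exact h1
  rw [← hm.map_eq]
  exact h.map hm.measurable

theorem measurePreserving_rotation (θ : ℝ) :
    MeasurePreserving (ContinuousLinearMap.rotation θ : E × E →L[ℝ] E × E)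
      ((stdGaussian E).prod (stdGaussian E)) ((stdGaussian E).prod (stdGaussian E)) :=
  ⟨by fun_prop, IsGaussian.map_rotation_eq_self (by simp) θ⟩

theorem lintegral_exp_dual_stdGaussian (L : StrongDual ℝ E) :
    ∫⁻ y, ENNReal.ofReal (exp (L y)) ∂stdGaussian E = ENNReal.ofReal (exp (‖L‖ ^ 2 / 2)) := by
  have hmap := IsGaussian.map_eq_gaussianReal (μ := stdGaussian E) L
  rw [integral_strongDual_stdGaussian, variance_dual_stdGaussian] at hmap
  have h1 : ∫⁻ y, ENNReal.ofReal (exp (L y)) ∂stdGaussian E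
      = ∫⁻ x, ENNReal.ofReal (exp x) ∂((stdGaussian E).map L) := by
    rw [lintegral_map (by fun_prop) (by fun_prop)]
  rw [h1, hmap]
  have hi := integrable_exp_mul_gaussianReal (μ := 0) (v := (‖L‖ ^ 2).toNNReal) 1
  have hg := mgf_gaussianReal (p := gaussianReal 0 (‖L‖ ^ 2).toNNReal) (X := id) (μ := 0)
    (v := (‖L‖ ^ 2).toNNReal) (by simp) 1
  simp only [mgf, id_eq, one_mul] at hg hi
  rw [← ofReal_integral_eq_lintegral_ofReal hi (Eventually.of_forall fun _ => (exp_pos _).le), hg]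
  simp

theorem integrable_exp_norm_stdGaussian (c : ℝ) :
    Integrable (fun x : E => exp (c * ‖x‖)) (stdGaussian E) := by
  obtain ⟨C, hC, hi⟩ := IsGaussian.exists_integrable_exp_sq (stdGaussian E)
  refine (hi.const_mul (exp (c ^ 2 / (4 * C)))).mono' (by fun_prop)
    (Eventually.of_forall fun x => ?_)
  rw [norm_of_nonneg (exp_pos _).le, ← exp_add, exp_le_exp]
  have : c ^ 2 / (4 * C) + C * ‖x‖ ^ 2 - c * ‖x‖ = (c - 2 * C * ‖x‖) ^ 2 / (4 * C) := by
    field_simp; ring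
  have h2 : 0 ≤ (c - 2 * C * ‖x‖) ^ 2 / (4 * C) := by positivity
  linarith

/-- Increment of `f` along a rotation of angle `h`. -/
def rotIncr (f : E → ℝ) (h : ℝ) (z : E × E) : ℝ :=
  f (ContinuousLinearMap.rotation h z).1 - f z.1

theorem abs_rotIncr_le {f : E → ℝ} (hf : LipschitzWith 1 f) {h : ℝ} (hh : 0 ≤ h) (z : E × E) :
    |rotIncr f h z| ≤ h * (‖z.1‖ + ‖z.2‖) := by
  have h1 := hf.dist_le_mul (ContinuousLinearMap.rotation h z).1 z.1
  rw [Real.dist_eq, NNReal.coe_one, one_mul, dist_eq_norm] at h1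
  refine h1.trans ?_
  have h2 : (ContinuousLinearMap.rotation h z).1 - z.1 = (cos h - 1) • z.1 + sin h • z.2 := by
    rw [ContinuousLinearMap.rotation_apply]; module
  rw [h2]
  refine (norm_add_le _ _).trans ?_
  rw [norm_smul, norm_smul, mul_add]
  have hs : ‖sin h‖ ≤ h := by
    simpa [abs_of_nonneg hh] using abs_sin_le_abs (x := h)
  have hc : ‖cos h - 1‖ ≤ h := by
    have := abs_cos_sub_cos_le h 0
    simpa [abs_of_nonneg hh] using this
  gcongr

theorem lintegral_exp_sub_le_rotIncr {f : E → ℝ} (hf : LipschitzWith 1 f) (l : ℝ) {n : ℕ}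
    (hn : 0 < n) :
    ∫⁻ z : E × E, ENNReal.ofReal (exp (l * (f z.2 - f z.1)))
        ∂(stdGaussian E).prod (stdGaussian E)
      ≤ ∫⁻ z : E × E, ENNReal.ofReal (exp (l * (n * rotIncr f (π / 2 / n) z)))
        ∂(stdGaussian E).prod (stdGaussian E) := by
  have hn' : (0 : ℝ) < n := Nat.cast_pos.2 hn
  have hcont : Continuous f := hf.continuous
  set h : ℝ := π / 2 / n with hh
  let T : ℕ → E × E →L[ℝ] E × E := fun k => ContinuousLinearMap.rotation (k * h)
  have hstep : ∀ k z, rotIncr f h (T k z) = f (T (k + 1) z).1 - f (T k z).1 := by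
    intro k z
    simp only [rotIncr]
    congr 2
    simp only [T, ContinuousLinearMap.rotation_apply]
    push_cast
    rw [add_mul, one_mul, cos_add, sin_add]
    module
  have hsum : ∀ z, ∑ k ∈ range n, rotIncr f h (T k z) = f z.2 - f z.1 := by
    intro z
    simp_rw [hstep]
    rw [Finset.sum_range_sub (fun k => f (T k z).1)]
    have h1 : (n : ℝ) * h = π / 2 := by rw [hh]; field_simp
    simp [T, ContinuousLinearMap.rotation_apply, h1]
  have hcontI : Continuous (rotIncr f h) := by unfold rotIncr; fun_prop
  calc ∫⁻ z : E × E, ENNReal.ofReal (exp (l * (f z.2 - f z.1)))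
        ∂(stdGaussian E).prod (stdGaussian E)
      ≤ ∫⁻ z : E × E, ∑ k ∈ range n, ENNReal.ofReal ((n : ℝ)⁻¹) *
          ENNReal.ofReal (exp (l * (n * rotIncr f h (T k z))))
          ∂(stdGaussian E).prod (stdGaussian E) := by
        refine lintegral_mono fun z => ?_
        have hj := convexOn_exp.map_sum_le (t := range n) (w := fun _ => (n : ℝ)⁻¹)
          (p := fun k => l * (n * rotIncr f h (T k z))) (fun _ _ => by positivity)
          (by simp [hn.ne']) (fun _ _ => Set.mem_univ _)
        have he : ∑ k ∈ range n, (n : ℝ)⁻¹ • (l * (n * rotIncr f h (T k z)))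
            = l * (f z.2 - f z.1) := by
          rw [← hsum z, Finset.mul_sum]
          refine Finset.sum_congr rfl fun k _ => ?_
          simp only [smul_eq_mul]; field_simp
        rw [he] at hj
        refine (ENNReal.ofReal_le_ofReal hj).trans ?_
        rw [ENNReal.ofReal_sum_of_nonneg (fun k _ => by positivity)]
        simp_rw [smul_eq_mul, ENNReal.ofReal_mul (inv_nonneg.2 hn'.le)]
        rfl
    _ = ∑ k ∈ range n, ENNReal.ofReal ((n : ℝ)⁻¹) * ∫⁻ z : E × E,
          ENNReal.ofReal (exp (l * (n * rotIncr f h z)))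
          ∂(stdGaussian E).prod (stdGaussian E) := by
        rw [lintegral_finsetSum _ (fun k _ => by fun_prop)]
        refine Finset.sum_congr rfl fun k _ => ?_
        rw [lintegral_const_mul _ (by fun_prop)]
        congr 1
        exact (measurePreserving_rotation (k * h)).lintegral_comp
          (f := fun z => ENNReal.ofReal (exp (l * (n * rotIncr f h z)))) (by fun_prop)
    _ = _ := by
        rw [Finset.sum_const, card_range, nsmul_eq_mul, ← mul_assoc,
          ← ENNReal.ofReal_natCast, ← ENNReal.ofReal_mul hn'.le, mul_inv_cancel₀ hn'.ne']
        simp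

theorem tendsto_rotIncr {f : E → ℝ} {z : E × E} (hd : DifferentiableAt ℝ f z.1) :
    Tendsto (fun n : ℕ => (n : ℝ) * rotIncr f (π / 2 / n) z) atTop
      (nhds (π / 2 * fderiv ℝ f z.1 z.2)) := by
  have hg : HasDerivAt (fun h : ℝ => f (ContinuousLinearMap.rotation h z).1)
      (fderiv ℝ f z.1 z.2) 0 := by
    have h1 : HasDerivAt (fun h : ℝ => (ContinuousLinearMap.rotation h z).1) z.2 0 := by
      simp only [ContinuousLinearMap.rotation_apply]
      refine (((hasDerivAt_cos 0).smul_const z.1).add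
        ((hasDerivAt_sin 0).smul_const z.2)).congr_deriv ?_
      simp
    have h0 : (ContinuousLinearMap.rotation 0 z).1 = z.1 := by
      simp [ContinuousLinearMap.rotation_apply]
    have hd' : HasFDerivAt f (fderiv ℝ f z.1) (ContinuousLinearMap.rotation 0 z).1 := by
      rw [h0]; exact hd.hasFDerivAt
    exact hd'.comp_hasDerivAt 0 h1
  have ht := hg.tendsto_slope_zero
  have hseq : Tendsto (fun n : ℕ => π / 2 / (n : ℝ)) atTop (nhdsWithin 0 {0}ᶜ) := by
    refine tendsto_nhdsWithin_iff.2 ⟨tendsto_const_div_atTop_nhds_zero_nat _, ?_⟩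
    filter_upwards [eventually_gt_atTop 0] with n hn
    have : (0 : ℝ) < n := Nat.cast_pos.2 hn
    simp only [Set.mem_compl_iff, Set.mem_singleton_iff]
    positivity
  refine ((ht.comp hseq).const_mul (π / 2)).congr' ?_
  filter_upwards [eventually_gt_atTop 0] with n hn
  have hn' : (0 : ℝ) < n := Nat.cast_pos.2 hn
  have h0 : (ContinuousLinearMap.rotation 0 z).1 = z.1 := by
    simp [ContinuousLinearMap.rotation_apply]
  simp only [Function.comp, zero_add, h0, smul_eq_mul, rotIncr]
  field_simp

/-- Exponential moments of increments of a `1`-Lipschitz function between two independent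
standard Gaussian vectors. -/
theorem lintegral_exp_sub_stdGaussian_le {f : E → ℝ} (hf : LipschitzWith 1 f) (l : ℝ) :
    ∫⁻ z : E × E, ENNReal.ofReal (exp (l * (f z.2 - f z.1)))
        ∂(stdGaussian E).prod (stdGaussian E)
      ≤ ENNReal.ofReal (exp (l ^ 2 * π ^ 2 / 8)) := by
  have hcont : Continuous f := hf.continuous
  have hdiff : ∀ᵐ z ∂(stdGaussian E).prod (stdGaussian E), DifferentiableAt ℝ f z.1 := by
    have h1 : ∀ᵐ x ∂stdGaussian E, DifferentiableAt ℝ f x :=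
      stdGaussian_absolutelyContinuous.ae_le hf.ae_differentiableAt
    exact Measure.quasiMeasurePreserving_fst.ae h1
  have hlim := tendsto_lintegral_of_dominated_convergence
    (μ := (stdGaussian E).prod (stdGaussian E))
    (F := fun (n : ℕ) z => ENNReal.ofReal (exp (l * (n * rotIncr f (π / 2 / n) z))))
    (f := fun z => ENNReal.ofReal (exp (l * (π / 2 * fderiv ℝ f z.1 z.2))))
    (fun z => ENNReal.ofReal (exp (|l| * (π / 2) * ‖z.1‖) * exp (|l| * (π / 2) * ‖z.2‖)))
    (fun n => by unfold rotIncr; fun_prop)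
    (fun n => Eventually.of_forall fun z => by
      refine ENNReal.ofReal_le_ofReal ?_
      rw [← exp_add, exp_le_exp]
      refine (le_abs_self _).trans ?_
      rw [abs_mul, abs_mul, Nat.abs_cast]
      have h1 := abs_rotIncr_le hf (h := π / 2 / n) (by positivity) z
      have h2 : (n : ℝ) * |rotIncr f (π / 2 / n) z| ≤ π / 2 * (‖z.1‖ + ‖z.2‖) := by
        rcases Nat.eq_zero_or_pos n with rfl | hn
        · simp; positivity
        · have hn' : (0 : ℝ) < n := Nat.cast_pos.2 hn
          calc (n : ℝ) * |rotIncr f (π / 2 / n) z|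
              ≤ n * (π / 2 / n * (‖z.1‖ + ‖z.2‖)) := by gcongr
            _ = _ := by field_simp
      calc |l| * (n * |rotIncr f (π / 2 / n) z|) ≤ |l| * (π / 2 * (‖z.1‖ + ‖z.2‖)) := by gcongr
        _ = _ := by ring)
    (((integrable_exp_norm_stdGaussian _).mul_prod
      (integrable_exp_norm_stdGaussian _)).lintegral_lt_top.ne)
    (by
      filter_upwards [hdiff] with z hz
      exact ENNReal.tendsto_ofReal
        ((continuous_exp.tendsto _).comp ((tendsto_rotIncr hz).const_mul l)))
  have hle : ∫⁻ z : E × E, ENNReal.ofReal (exp (l * (f z.2 - f z.1)))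
        ∂(stdGaussian E).prod (stdGaussian E)
      ≤ ∫⁻ z : E × E, ENNReal.ofReal (exp (l * (π / 2 * fderiv ℝ f z.1 z.2)))
        ∂(stdGaussian E).prod (stdGaussian E) :=
    ge_of_tendsto hlim (by
      filter_upwards [eventually_gt_atTop 0] with n hn
      exact lintegral_exp_sub_le_rotIncr hf l hn)
  refine hle.trans ((lintegral_prod_le _).trans ?_)
  calc ∫⁻ x, ∫⁻ y, ENNReal.ofReal (exp (l * (π / 2 * fderiv ℝ f x y))) ∂stdGaussian E
        ∂stdGaussian E
      ≤ ∫⁻ _x, ENNReal.ofReal (exp (l ^ 2 * π ^ 2 / 8)) ∂stdGaussian E := by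
        refine lintegral_mono fun x => ?_
        have h1 := lintegral_exp_dual_stdGaussian ((l * (π / 2)) • fderiv ℝ f x)
        simp only [FunLike.coe_smul, Pi.smul_apply, smul_eq_mul, mul_assoc] at h1
        rw [h1]
        refine ENNReal.ofReal_le_ofReal (exp_le_exp.2 ?_)
        have h2 : ‖fderiv ℝ f x‖ ≤ 1 := by
          simpa using norm_fderiv_le_of_lipschitz ℝ hf (x₀ := x)
        rw [norm_smul, mul_pow, norm_eq_abs, sq_abs]
        have h3 : ‖fderiv ℝ f x‖ ^ 2 ≤ 1 := pow_le_one₀ (norm_nonneg _) h2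
        nlinarith [mul_nonneg (sq_nonneg (l * (π / 2))) (sub_nonneg.2 h3)]
    _ = _ := by simp

/-- Gaussian concentration around a set of positive measure. -/
theorem measure_mul_measure_infDist_stdGaussian_le {A : Set E} (hA : MeasurableSet A) {r : ℝ}
    (hr : 0 ≤ r) :
    stdGaussian E A * stdGaussian E {y | r ≤ Metric.infDist y A}
      ≤ ENNReal.ofReal (exp (-(2 * r ^ 2 / π ^ 2))) := by
  have hf : LipschitzWith 1 fun x : E => Metric.infDist x A := Metric.lipschitz_infDist_pt A
  set l : ℝ := 4 * r / π ^ 2 with hl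
  have hB : MeasurableSet {y : E | r ≤ Metric.infDist y A} :=
    measurableSet_le measurable_const hf.continuous.measurable
  have h1 := lintegral_exp_sub_stdGaussian_le hf l
  have h2 : ENNReal.ofReal (exp (l * r)) *
      (stdGaussian E A * stdGaussian E {y | r ≤ Metric.infDist y A})
      ≤ ENNReal.ofReal (exp (l ^ 2 * π ^ 2 / 8)) := by
    rw [← Measure.prod_prod]
    refine le_trans ?_ h1
    rw [← lintegral_indicator_const (hA.prod hB)]
    refine lintegral_mono fun z => ?_
    by_cases hz : z ∈ A ×ˢ {y : E | r ≤ Metric.infDist y A}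
    · rw [Set.indicator_of_mem hz]
      refine ENNReal.ofReal_le_ofReal (exp_le_exp.2 ?_)
      rw [Metric.infDist_zero_of_mem hz.1, sub_zero]
      have : 0 ≤ l := by positivity
      exact mul_le_mul_of_nonneg_left hz.2 this
    · rw [Set.indicator_of_notMem hz]; exact bot_le
  have h3 : ENNReal.ofReal (exp (-(2 * r ^ 2 / π ^ 2)))
      = ENNReal.ofReal (exp (-(l * r))) * ENNReal.ofReal (exp (l ^ 2 * π ^ 2 / 8)) := by
    rw [← ENNReal.ofReal_mul (exp_pos _).le, ← exp_add]
    congr 2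
    rw [hl]; field_simp; ring
  rw [h3]
  calc _ = ENNReal.ofReal (exp (-(l * r))) * (ENNReal.ofReal (exp (l * r)) *
      (stdGaussian E A * stdGaussian E {y | r ≤ Metric.infDist y A})) := by
        rw [← mul_assoc, ← ENNReal.ofReal_mul (exp_pos _).le, ← exp_add]; simp
    _ ≤ _ := by gcongr

end Concentration

/-! ### Replica averages of a finite Gibbs measure -/

section Replicas

variable {S : Type*} [Fintype S] {n : ℕ}

/-- Normalised Gibbs weight of a finite system with energy `H`. -/
def gibbsWeight (H : S → ℝ) (σ : S) : ℝ := exp (H σ) / ∑ τ, exp (H τ)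

/-- Product Gibbs weight of `n` replicas. -/
def replicaWeight (H : S → ℝ) (ρ : Fin n → S) : ℝ := ∏ l, gibbsWeight H (ρ l)

/-- Gibbs average over `n` replicas. -/
def replicaAvg (H : S → ℝ) (F : (Fin n → S) → ℝ) : ℝ := ∑ ρ, F ρ * replicaWeight H ρ

theorem gibbsWeight_nonneg (H : S → ℝ) (σ : S) : 0 ≤ gibbsWeight H σ := by
  unfold gibbsWeight; positivity

theorem replicaWeight_nonneg (H : S → ℝ) (ρ : Fin n → S) : 0 ≤ replicaWeight H ρ :=
  Finset.prod_nonneg fun _ _ => gibbsWeight_nonneg H _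

theorem sum_exp_pos [Nonempty S] (H : S → ℝ) : 0 < ∑ τ, exp (H τ) :=
  Finset.sum_pos (fun _ _ => exp_pos _) univ_nonempty

theorem sum_gibbsWeight [Nonempty S] (H : S → ℝ) : ∑ σ, gibbsWeight H σ = 1 := by
  simp only [gibbsWeight]
  rw [← Finset.sum_div, div_self (sum_exp_pos H).ne']

theorem sum_replicaWeight [Nonempty S] (H : S → ℝ) :
    ∑ ρ : Fin n → S, replicaWeight H ρ = 1 := by
  simp only [replicaWeight]
  rw [← Fintype.piFinset_univ, ← Finset.prod_univ_sum]
  simp [sum_gibbsWeight]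

theorem replicaWeight_le_one [Nonempty S] (H : S → ℝ) (ρ : Fin n → S) :
    replicaWeight H ρ ≤ 1 := by
  rw [← sum_replicaWeight (n := n) H]
  exact Finset.single_le_sum (f := fun ρ => replicaWeight H ρ)
    (fun ρ _ => replicaWeight_nonneg H ρ) (mem_univ ρ)

theorem replicaAvg_mono (H : S → ℝ) {F G : (Fin n → S) → ℝ} (h : ∀ ρ, F ρ ≤ G ρ) :
    replicaAvg H F ≤ replicaAvg H G :=
  Finset.sum_le_sum fun ρ _ => mul_le_mul_of_nonneg_right (h ρ) (replicaWeight_nonneg H ρ)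

theorem abs_replicaAvg_le [Nonempty S] (H : S → ℝ) (F : (Fin n → S) → ℝ) :
    |replicaAvg H F| ≤ ∑ ρ, |F ρ| := by
  refine (Finset.abs_sum_le_sum_abs _ _).trans (Finset.sum_le_sum fun ρ _ => ?_)
  rw [abs_mul, abs_of_nonneg (replicaWeight_nonneg H ρ)]
  exact mul_le_of_le_one_right (abs_nonneg _) (replicaWeight_le_one H ρ)

theorem replicaAvg_const [Nonempty S] (H : S → ℝ) (c : ℝ) :
    replicaAvg H (fun _ : Fin n → S => c) = c := by
  simp only [replicaAvg]
  rw [← Finset.mul_sum, sum_replicaWeight, mul_one]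

theorem replicaAvg_add (H : S → ℝ) (F G : (Fin n → S) → ℝ) :
    replicaAvg H (fun ρ => F ρ + G ρ) = replicaAvg H F + replicaAvg H G := by
  simp only [replicaAvg, add_mul, Finset.sum_add_distrib]

theorem replicaAvg_const_mul (H : S → ℝ) (c : ℝ) (F : (Fin n → S) → ℝ) :
    replicaAvg H (fun ρ => c * F ρ) = c * replicaAvg H F := by
  simp only [replicaAvg, Finset.mul_sum, mul_assoc]

theorem replicaAvg_sum {ι : Type*} (s : Finset ι) (H : S → ℝ) (F : ι → (Fin n → S) → ℝ) :
    replicaAvg H (fun ρ => ∑ a ∈ s, F a ρ) = ∑ a ∈ s, replicaAvg H (F a) := by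
  simp only [replicaAvg, Finset.sum_mul]
  exact Finset.sum_comm

/-- A symmetry of the energy may be applied to a single replica. -/
theorem replicaAvg_update_symmetry (H : S → ℝ) (T : Equiv.Perm S) (hT : ∀ σ, H (T σ) = H σ)
    (l : Fin n) (F : (Fin n → S) → ℝ) :
    replicaAvg H (fun ρ => F (Function.update ρ l (T (ρ l)))) = replicaAvg H F := by
  let e : Equiv.Perm (Fin n → S) :=
    Equiv.piCongrRight fun k => if k = l then T else Equiv.refl S
  have he : ∀ ρ, e ρ = Function.update ρ l (T (ρ l)) := by
    intro ρ
    funext k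
    by_cases hk : k = l
    · subst hk; simp [e]
    · simp [e, hk]
  simp only [replicaAvg]
  rw [← Equiv.sum_comp e (fun ρ => F ρ * replicaWeight H ρ)]
  refine Finset.sum_congr rfl fun ρ _ => ?_
  rw [he]
  congr 1
  simp only [replicaWeight]
  refine Finset.prod_congr rfl fun k _ => ?_
  by_cases hk : k = l
  · subst hk; simp [gibbsWeight, hT]
  · simp [hk]

/-- Resampling one replica does not change the replica average. -/
theorem replicaAvg_resample [Nonempty S] (H : S → ℝ) (l : Fin n) (F : (Fin n → S) → ℝ) :
    replicaAvg H F
      = replicaAvg H (fun ρ => ∑ x, gibbsWeight H x * F (Function.update ρ l x)) := by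
  let inv : (Fin n → S) × S → (Fin n → S) × S := fun z => (Function.update z.1 l z.2, z.1 l)
  have hinv : Function.Involutive inv := by
    intro z
    simp [inv]
  have hw : ∀ ρ x, replicaWeight H (Function.update ρ l x) * gibbsWeight H (ρ l)
      = replicaWeight H ρ * gibbsWeight H x := by
    intro ρ x
    simp only [replicaWeight]
    rw [← Finset.mul_prod_erase univ _ (mem_univ l),
      ← Finset.mul_prod_erase univ (fun k => gibbsWeight H (ρ k)) (mem_univ l)]
    have : ∏ k ∈ univ.erase l, gibbsWeight H (Function.update ρ l x k)
        = ∏ k ∈ univ.erase l, gibbsWeight H (ρ k) :=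
      Finset.prod_congr rfl fun k hk => by
        rw [Function.update_of_ne (Finset.ne_of_mem_erase hk)]
    rw [this, Function.update_self]
    ring
  have h1 : replicaAvg H (fun ρ => ∑ x, gibbsWeight H x * F (Function.update ρ l x))
      = ∑ z : (Fin n → S) × S, F z.1 * (replicaWeight H z.1 * gibbsWeight H z.2) := by
    rw [← Equiv.sum_comp hinv.toPerm, Fintype.sum_prod_type]
    simp only [replicaAvg]
    refine Finset.sum_congr rfl fun ρ _ => ?_
    rw [Finset.sum_mul]
    refine Finset.sum_congr rfl fun x _ => ?_
    simp only [Function.Involutive.coe_toPerm, inv]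
    rw [hw]; ring
  rw [h1, Fintype.sum_prod_type]
  simp only [replicaAvg, ← mul_assoc]
  refine Finset.sum_congr rfl fun ρ _ => ?_
  rw [← Finset.mul_sum, sum_gibbsWeight, mul_one]

theorem replicaAvg_three [Nonempty S] (H : S → ℝ) {a b c : Fin n} (hab : a ≠ b) (hac : a ≠ c)
    (hbc : b ≠ c) (Φ : S → S → S → ℝ) :
    replicaAvg H (fun ρ => Φ (ρ a) (ρ b) (ρ c))
      = ∑ z, gibbsWeight H z * ∑ x, gibbsWeight H x * ∑ y, gibbsWeight H y * Φ x y z := by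
  rw [replicaAvg_resample H b, replicaAvg_resample H a, replicaAvg_resample H c]
  simp only [Function.update_self, Function.update_of_ne hab, Function.update_of_ne hac.symm,
    Function.update_of_ne hbc.symm]
  exact replicaAvg_const H _

theorem replicaAvg_two [Nonempty S] (H : S → ℝ) {a b : Fin n} (hab : a ≠ b) (Φ : S → S → ℝ) :
    replicaAvg H (fun ρ => Φ (ρ a) (ρ b))
      = ∑ x, gibbsWeight H x * ∑ y, gibbsWeight H y * Φ x y := by
  rw [replicaAvg_resample H b, replicaAvg_resample H a]
  simp only [Function.update_self, Function.update_of_ne hab]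
  exact replicaAvg_const H _

end Replicas

/-! ### Positive-definite kernels -/

section GramKernel

variable {S : Type*}

/-- Kernels that are Gram matrices of finitely many functions. -/
def IsGramKernel (K : S → S → ℝ) : Prop :=
  ∃ (k : ℕ) (φ : Fin k → S → ℝ), ∀ x y, K x y = ∑ a, φ a x * φ a y

theorem IsGramKernel.of_fintype {ι : Type*} [Fintype ι] (φ : ι → S → ℝ) :
    IsGramKernel fun x y => ∑ a, φ a x * φ a y := by
  refine ⟨Fintype.card ι, fun a => φ ((Fintype.equivFin ι).symm a), fun x y => ?_⟩
  exact (Equiv.sum_comp (Fintype.equivFin ι).symm fun a => φ a x * φ a y).symm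

theorem IsGramKernel.rankOne (φ : S → ℝ) : IsGramKernel fun x y => φ x * φ y := by
  refine ⟨1, fun _ => φ, fun x y => ?_⟩
  simp

theorem IsGramKernel.mul {K L : S → S → ℝ} (hK : IsGramKernel K) (hL : IsGramKernel L) :
    IsGramKernel fun x y => K x y * L x y := by
  obtain ⟨k, φ, hφ⟩ := hK
  obtain ⟨l, ψ, hψ⟩ := hL
  have h := IsGramKernel.of_fintype fun (a : Fin k × Fin l) x => φ a.1 x * ψ a.2 x
  convert h using 3 with x y
  rw [hφ, hψ, Finset.sum_mul_sum, Fintype.sum_prod_type]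
  exact Finset.sum_congr rfl fun a _ => Finset.sum_congr rfl fun b _ => by ring

theorem IsGramKernel.pow {K : S → S → ℝ} (hK : IsGramKernel K) (m : ℕ) :
    IsGramKernel fun x y => K x y ^ m := by
  induction m with
  | zero => simpa using IsGramKernel.rankOne fun _ : S => (1 : ℝ)
  | succ m ih => simpa [pow_succ] using ih.mul hK

variable [Fintype S] [Nonempty S] {n : ℕ}

theorem IsGramKernel.replicaAvg_nonneg {K : S → S → ℝ} (hK : IsGramKernel K) (H : S → ℝ)
    {a b : Fin n} (hab : a ≠ b) : 0 ≤ replicaAvg H (fun ρ => K (ρ a) (ρ b)) := by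
  obtain ⟨k, φ, hφ⟩ := hK
  simp_rw [hφ]
  rw [replicaAvg_sum]
  refine Finset.sum_nonneg fun i _ => ?_
  rw [replicaAvg_two H hab fun x y => φ i x * φ i y]
  have : ∑ x, gibbsWeight H x * ∑ y, gibbsWeight H y * (φ i x * φ i y)
      = (∑ x, gibbsWeight H x * φ i x) ^ 2 := by
    rw [sq, Finset.sum_mul]
    refine Finset.sum_congr rfl fun x _ => ?_
    rw [Finset.mul_sum, Finset.mul_sum]
    exact Finset.sum_congr rfl fun y _ => by ring
  rw [this]
  positivity

theorem IsGramKernel.replicaAvg_mul_nonneg {K : S → S → ℝ} (hK : IsGramKernel K) (H : S → ℝ)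
    (ψ : S → S → ℝ) {a b c : Fin n} (hab : a ≠ b) (hac : a ≠ c) (hbc : b ≠ c) :
    0 ≤ replicaAvg H (fun ρ => K (ρ a) (ρ b) * ψ (ρ a) (ρ c) * ψ (ρ b) (ρ c)) := by
  obtain ⟨k, φ, hφ⟩ := hK
  simp_rw [hφ, Finset.sum_mul]
  rw [replicaAvg_sum]
  refine Finset.sum_nonneg fun i _ => ?_
  rw [replicaAvg_three H hab hac hbc fun x y z => φ i x * φ i y * ψ x z * ψ y z]
  refine Finset.sum_nonneg fun z _ => mul_nonneg (gibbsWeight_nonneg H z) ?_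
  have : ∑ x, gibbsWeight H x * ∑ y, gibbsWeight H y * (φ i x * φ i y * ψ x z * ψ y z)
      = (∑ x, gibbsWeight H x * (φ i x * ψ x z)) ^ 2 := by
    rw [sq, Finset.sum_mul]
    refine Finset.sum_congr rfl fun x _ => ?_
    rw [Finset.mul_sum, Finset.mul_sum]
    exact Finset.sum_congr rfl fun y _ => by ring
  rw [this]
  positivity

end GramKernel

/-! ### Derivatives of replica averages -/

section ReplicaDerivative

variable {S : Type*} {n : ℕ}

/-- The function `F` depends on the first `m` replicas only. -/
def DependsOnFirst (m : ℕ) (F : (Fin n → S) → ℝ) : Prop :=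
  ∀ ρ ρ' : Fin n → S, (∀ l : Fin n, (l : ℕ) < m → ρ l = ρ' l) → F ρ = F ρ'

/-- Coefficients of the replicas in the derivative of an average over `m` replicas. -/
def replicaCoeff (m l : ℕ) : ℝ := if l < m then 1 else if l = m then -m else 0

/-- The observable produced by differentiating an average over `m` replicas in the direction
of the energy variation `h`. -/
def replicaDiff (m : ℕ) (h : S → ℝ) (ρ : Fin n → S) : ℝ :=
  ∑ l : Fin n, replicaCoeff m l * h (ρ l)

theorem DependsOnFirst.mul_replicaDiff {m : ℕ} {F : (Fin n → S) → ℝ} (hF : DependsOnFirst m F)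
    (h : S → ℝ) : DependsOnFirst (m + 1) fun ρ => F ρ * replicaDiff m h ρ := by
  intro ρ ρ' hρ
  have h1 : F ρ = F ρ' := hF ρ ρ' fun l hl => hρ l (by lia)
  have h2 : replicaDiff m h ρ = replicaDiff m h ρ' := by
    refine Finset.sum_congr rfl fun l _ => ?_
    by_cases hl : (l : ℕ) < m + 1
    · rw [hρ l hl]
    · have : replicaCoeff m l = 0 := by
        rw [replicaCoeff, if_neg (by lia), if_neg (by lia)]
      simp [this]
  simp only [h1, h2]

theorem abs_replicaCoeff_le {m l : ℕ} : |replicaCoeff m l| ≤ m + 1 := by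
  unfold replicaCoeff
  split_ifs <;> simp <;> positivity

variable [Fintype S]

theorem hasDerivAt_gibbsWeight [Nonempty S] {H : ℝ → S → ℝ} {h : S → ℝ} {t : ℝ}
    (hH : ∀ σ, HasDerivAt (fun t => H t σ) (h σ) t) (σ : S) :
    HasDerivAt (fun t => gibbsWeight (H t) σ)
      (gibbsWeight (H t) σ * (h σ - ∑ τ, gibbsWeight (H t) τ * h τ)) t := by
  have h1 : ∀ σ, HasDerivAt (fun t => exp (H t σ)) (exp (H t σ) * h σ) t := fun σ => (hH σ).exp
  have h2 : HasDerivAt (fun t => ∑ τ, exp (H t τ)) (∑ τ, exp (H t τ) * h τ) t :=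
    HasDerivAt.fun_sum fun τ _ => h1 τ
  have hpos := sum_exp_pos (H t)
  refine ((h1 σ).div h2 hpos.ne').congr_deriv ?_
  have h3 : ∑ τ, gibbsWeight (H t) τ * h τ = (∑ τ, exp (H t τ) * h τ) / ∑ τ, exp (H t τ) := by
    rw [Finset.sum_div]
    refine Finset.sum_congr rfl fun τ _ => ?_
    rw [gibbsWeight]; ring
  rw [h3, gibbsWeight]
  field_simp

theorem replicaAvg_mul_of_dependsOnFirst [Nonempty S] (H : S → ℝ) {m : ℕ}
    {F : (Fin n → S) → ℝ} (hF : DependsOnFirst m F) (h : S → ℝ) {l : Fin n} (hl : m ≤ l) :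
    replicaAvg H (fun ρ => F ρ * h (ρ l)) = replicaAvg H F * ∑ x, gibbsWeight H x * h x := by
  rw [replicaAvg_resample H l, mul_comm, ← replicaAvg_const_mul]
  congr 1
  funext ρ
  rw [Finset.sum_mul]
  refine Finset.sum_congr rfl fun x _ => ?_
  have : F (Function.update ρ l x) = F ρ := by
    refine hF _ _ fun k hk => ?_
    rw [Function.update_of_ne]
    rintro rfl
    lia
  rw [this, Function.update_self]
  ring

theorem hasDerivAt_replicaAvg [Nonempty S] {H : ℝ → S → ℝ} {h : S → ℝ} {t : ℝ}
    (hH : ∀ σ, HasDerivAt (fun t => H t σ) (h σ) t) {m : ℕ} (hm : m < n)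
    {F : (Fin n → S) → ℝ} (hF : DependsOnFirst m F) :
    HasDerivAt (fun t => replicaAvg (H t) F)
      (replicaAvg (H t) (fun ρ => F ρ * replicaDiff m h ρ)) t := by
  set a := ∑ τ, gibbsWeight (H t) τ * h τ with ha
  have h1 : HasDerivAt (fun t => replicaAvg (H t) F)
      (∑ ρ, F ρ * ∑ l, (∏ k ∈ univ.erase l, gibbsWeight (H t) (ρ k)) •
        (gibbsWeight (H t) (ρ l) * (h (ρ l) - a))) t := by
    refine HasDerivAt.fun_sum fun ρ _ => HasDerivAt.const_mul _ ?_
    exact HasDerivAt.fun_finsetProd fun l _ => hasDerivAt_gibbsWeight hH (ρ l)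
  refine h1.congr_deriv ?_
  have h2 : ∀ ρ : Fin n → S, F ρ * ∑ l, (∏ k ∈ univ.erase l, gibbsWeight (H t) (ρ k)) •
        (gibbsWeight (H t) (ρ l) * (h (ρ l) - a))
      = (∑ l, (F ρ * h (ρ l) + (-a) * F ρ)) * replicaWeight (H t) ρ := by
    intro ρ
    rw [Finset.mul_sum, Finset.sum_mul]
    refine Finset.sum_congr rfl fun l _ => ?_
    rw [replicaWeight, ← Finset.prod_erase_mul univ _ (mem_univ l), smul_eq_mul]
    ring
  rw [Finset.sum_congr rfl fun ρ _ => h2 ρ]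
  change replicaAvg (H t) (fun ρ => ∑ l, (F ρ * h (ρ l) + (-a) * F ρ)) = _
  simp only [replicaDiff, Finset.mul_sum]
  rw [replicaAvg_sum, replicaAvg_sum]
  have h3 : ∀ l : Fin n, replicaAvg (H t) (fun ρ => F ρ * (replicaCoeff m l * h (ρ l)))
      = replicaCoeff m l * replicaAvg (H t) (fun ρ => F ρ * h (ρ l)) := by
    intro l
    rw [← replicaAvg_const_mul]
    congr 1; funext ρ; ring
  simp only [h3, replicaAvg_add, replicaAvg_const_mul]
  set A := replicaAvg (H t) F
  have hge : ∀ l : Fin n, m ≤ (l : ℕ) → replicaAvg (H t) (fun ρ => F ρ * h (ρ l)) = A * a :=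
    fun l hl => replicaAvg_mul_of_dependsOnFirst (H t) hF h hl
  have hlt : ∀ l : Fin n, replicaAvg (H t) (fun ρ => F ρ * h (ρ l)) + -a * A
      - replicaCoeff m l * replicaAvg (H t) (fun ρ => F ρ * h (ρ l))
      = A * a * ((if l = (⟨m, hm⟩ : Fin n) then (m : ℝ) else 0)
          - if (l : ℕ) < m then 1 else 0) := by
    intro l
    rcases lt_trichotomy (l : ℕ) m with hl | hl | hl
    · have : l ≠ ⟨m, hm⟩ := by rintro rfl; simp at hl
      simp [replicaCoeff, hl, this]; ring
    · have : l = ⟨m, hm⟩ := Fin.ext hl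
      rw [hge l hl.ge]
      simp [replicaCoeff, this]; ring
    · have h4 : l ≠ ⟨m, hm⟩ := by rintro rfl; simp at hl
      rw [hge l hl.le]
      simp [replicaCoeff, h4, hl.not_gt, hl.ne']; ring
  rw [← sub_eq_zero, ← Finset.sum_sub_distrib, Finset.sum_congr rfl fun l _ => hlt l,
    ← Finset.mul_sum, Finset.sum_sub_distrib]
  have hcard : ∑ l : Fin n, (if (l : ℕ) < m then (1 : ℝ) else 0) = m := by
    rw [Fin.sum_univ_eq_sum_range (fun l => if l < m then (1 : ℝ) else 0), ← Finset.sum_filter]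
    have : (range n).filter (· < m) = range m := by ext x; simp; lia
    rw [this]; simp
  rw [hcard]
  simp

end ReplicaDerivative

/-! ### Disorder averages with a tunable Gaussian part -/

section Disorder

variable {S P : Type*} [Fintype P] {n : ℕ}

/-- Gaussian energy whose `v` part is switched on by the parameter `u`. -/
def tunedEnergy (b v : P → S → ℝ) (u : ℝ) (g : P → ℝ) (σ : S) : ℝ :=
  ∑ p, g p * (b p σ + u * v p σ)

/-- Covariance observable appearing in the derivative of a disorder average. -/
def covObservable (v : P → S → ℝ) (m : ℕ) (ρ : Fin n → S) : ℝ :=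
  ∑ p, replicaDiff m (v p) ρ * replicaDiff (m + 1) (v p) ρ

variable [Fintype S]

/-- Disorder expectation of the replica average. -/
def disorderAvg (b v : P → S → ℝ) (u : ℝ) (F : (Fin n → S) → ℝ) : ℝ :=
  ∫ g, replicaAvg (tunedEnergy b v u g) F ∂gaussProd P

variable [Nonempty S] {b v : P → S → ℝ} {u : ℝ}

theorem continuous_replicaAvg_tunedEnergy (F : (Fin n → S) → ℝ) :
    Continuous fun g : P → ℝ => replicaAvg (tunedEnergy b v u g) F := by
  simp only [replicaAvg, replicaWeight, gibbsWeight]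
  have h : ∀ σ, Continuous fun g : P → ℝ => exp (tunedEnergy b v u g σ) := by
    intro σ; unfold tunedEnergy; fun_prop
  refine continuous_finsetSum _ fun ρ _ => continuous_const.mul
    (continuous_finsetProd _ fun l _ => (h _).div (continuous_finsetSum _ fun τ _ => h τ) ?_)
  exact fun g => (sum_exp_pos _).ne'

theorem integrable_replicaAvg_tunedEnergy (F : (Fin n → S) → ℝ) :
    Integrable (fun g : P → ℝ => replicaAvg (tunedEnergy b v u g) F) (gaussProd P) :=
  Integrable.of_bound (continuous_replicaAvg_tunedEnergy F).aestronglyMeasurable _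
    (Eventually.of_forall fun _ => abs_replicaAvg_le _ F)

theorem disorderAvg_mono {F G : (Fin n → S) → ℝ} (h : ∀ ρ, F ρ ≤ G ρ) :
    disorderAvg b v u F ≤ disorderAvg b v u G :=
  integral_mono (integrable_replicaAvg_tunedEnergy F) (integrable_replicaAvg_tunedEnergy G)
    fun _ => replicaAvg_mono _ h

theorem disorderAvg_nonneg {F : (Fin n → S) → ℝ} (h : ∀ ρ, 0 ≤ F ρ) : 0 ≤ disorderAvg b v u F :=
  integral_nonneg fun _ => Finset.sum_nonneg fun ρ _ =>
    mul_nonneg (h ρ) (replicaWeight_nonneg _ ρ)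

theorem disorderAvg_add (F G : (Fin n → S) → ℝ) :
    disorderAvg b v u (fun ρ => F ρ + G ρ) = disorderAvg b v u F + disorderAvg b v u G := by
  simp only [disorderAvg, replicaAvg_add]
  exact integral_add (integrable_replicaAvg_tunedEnergy F) (integrable_replicaAvg_tunedEnergy G)

theorem disorderAvg_const_mul (c : ℝ) (F : (Fin n → S) → ℝ) :
    disorderAvg b v u (fun ρ => c * F ρ) = c * disorderAvg b v u F := by
  simp only [disorderAvg, replicaAvg_const_mul]
  exact integral_const_mul _ _

theorem disorderAvg_const (c : ℝ) : disorderAvg b v u (fun _ : Fin n → S => c) = c := by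
  simp [disorderAvg, replicaAvg_const]

theorem disorderAvg_sum {ι : Type*} (s : Finset ι) (F : ι → (Fin n → S) → ℝ) :
    disorderAvg b v u (fun ρ => ∑ a ∈ s, F a ρ) = ∑ a ∈ s, disorderAvg b v u (F a) := by
  simp only [disorderAvg, replicaAvg_sum]
  exact integral_finsetSum _ fun a _ => integrable_replicaAvg_tunedEnergy (F a)

theorem abs_disorderAvg_le {F G : (Fin n → S) → ℝ} (h : ∀ ρ, |F ρ| ≤ G ρ) :
    |disorderAvg b v u F| ≤ disorderAvg b v u G := by
  refine abs_le.2 ⟨?_, disorderAvg_mono fun ρ => (le_abs_self _).trans (h ρ)⟩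
  have := disorderAvg_mono (b := b) (v := v) (u := u) (F := fun ρ => (-1) * G ρ) (G := F)
    fun ρ => by linarith [neg_le_of_abs_le (h ρ)]
  rw [disorderAvg_const_mul] at this
  linarith

/-- A symmetry of the untuned part may be applied to one replica when `u = 0`. -/
theorem disorderAvg_update_symmetry (T : Equiv.Perm S) (hT : ∀ p σ, b p (T σ) = b p σ)
    (l : Fin n) (F : (Fin n → S) → ℝ) :
    disorderAvg b v 0 (fun ρ => F (Function.update ρ l (T (ρ l)))) = disorderAvg b v 0 F := by
  refine integral_congr_ae (Eventually.of_forall fun g => ?_)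
  exact replicaAvg_update_symmetry _ T (fun σ => by simp [tunedEnergy, hT]) l F

theorem integral_coord_mul_replicaAvg (p : P) {m : ℕ} (hm : m < n) {F : (Fin n → S) → ℝ}
    (hF : DependsOnFirst m F) :
    ∫ g : P → ℝ, g p * replicaAvg (tunedEnergy b v u g) F ∂gaussProd P
      = disorderAvg b v u fun ρ => F ρ * replicaDiff m (fun σ => b p σ + u * v p σ) ρ := by
  classical
  refine integral_coord_mul_eq_integral_deriv p
    (continuous_replicaAvg_tunedEnergy F).measurable
    (continuous_replicaAvg_tunedEnergy _).measurable (fun g x => ?_)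
    (fun g => abs_replicaAvg_le _ F) (fun g => abs_replicaAvg_le _ _)
  refine hasDerivAt_replicaAvg (H := fun t => tunedEnergy b v u (Function.update g p t))
    (fun σ => ?_) hm hF
  have h1 : HasDerivAt (fun t => ∑ q, Function.update g p t q * (b q σ + u * v q σ))
      (∑ q, (if q = p then 1 else 0) * (b q σ + u * v q σ)) x := by
    refine HasDerivAt.fun_sum fun q _ => HasDerivAt.mul_const ?_ _
    by_cases hq : q = p
    · subst hq; simpa using hasDerivAt_id' x
    · simpa [hq] using hasDerivAt_const x (g q)
  refine h1.congr_deriv ?_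
  simp

/-- Derivative of a disorder average with respect to the strength of the tuned part. -/
theorem hasDerivAt_disorderAvg (hbv : ∀ p, (∀ σ, b p σ = 0) ∨ ∀ σ, v p σ = 0) {m : ℕ}
    (hm : m + 1 < n) {F : (Fin n → S) → ℝ} (hF : DependsOnFirst m F) (u : ℝ) :
    HasDerivAt (fun u => disorderAvg b v u F)
      (u * disorderAvg b v u fun ρ => F ρ * covObservable v m ρ) u := by
  have hd : ∀ (u : ℝ) (g : P → ℝ), HasDerivAt (fun u => replicaAvg (tunedEnergy b v u g) F)
      (∑ p, g p * replicaAvg (tunedEnergy b v u g) (fun ρ => F ρ * replicaDiff m (v p) ρ)) u := by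
    intro u g
    have h1 := hasDerivAt_replicaAvg (H := fun u => tunedEnergy b v u g)
      (h := fun σ => ∑ p, g p * v p σ) (t := u) (fun σ => by
        refine HasDerivAt.fun_sum fun p _ => ?_
        exact (((hasDerivAt_id' u).mul_const (v p σ)).const_add (b p σ)).const_mul (g p)
          |>.congr_deriv (by ring)) (show m < n by lia) hF
    refine h1.congr_deriv ?_
    simp_rw [← replicaAvg_const_mul]
    rw [← replicaAvg_sum]
    congr 1
    funext ρ
    simp only [replicaDiff, Finset.mul_sum]
    rw [Finset.sum_comm]
    exact Finset.sum_congr rfl fun p _ => Finset.sum_congr rfl fun l _ => by ring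
  have hbound : ∀ (u : ℝ) (g : P → ℝ),
      ‖∑ p, g p * replicaAvg (tunedEnergy b v u g) (fun ρ => F ρ * replicaDiff m (v p) ρ)‖
        ≤ ∑ p, |g p| * ∑ ρ, |F ρ * replicaDiff m (v p) ρ| := by
    intro u g
    refine (norm_sum_le _ _).trans (Finset.sum_le_sum fun p _ => ?_)
    rw [norm_mul]
    exact mul_le_mul_of_nonneg_left (abs_replicaAvg_le _ _) (norm_nonneg _)
  have key := (hasDerivAt_integral_of_dominated_loc_of_deriv_le (μ := gaussProd P)
    (F := fun u g => replicaAvg (tunedEnergy b v u g) F)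
    (F' := fun u g => ∑ p, g p *
      replicaAvg (tunedEnergy b v u g) (fun ρ => F ρ * replicaDiff m (v p) ρ))
    (x₀ := u) (s := Set.univ) univ_mem
    (Eventually.of_forall fun u => (integrable_replicaAvg_tunedEnergy F).aestronglyMeasurable)
    (integrable_replicaAvg_tunedEnergy F)
    (Continuous.aestronglyMeasurable (by
      refine continuous_finsetSum _ fun p _ => (continuous_apply p).mul
        (continuous_replicaAvg_tunedEnergy _)))
    (Eventually.of_forall fun g u _ => hbound u g)
    (integrable_finsetSum _ fun p _ => (integrable_eval_gaussProd p).abs.mul_const _)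
    (Eventually.of_forall fun g u _ => hd u g)).2
  refine key.congr_deriv ?_
  rw [integral_finsetSum]
  · have h2 : ∀ p, ∫ g : P → ℝ, g p * replicaAvg (tunedEnergy b v u g)
          (fun ρ => F ρ * replicaDiff m (v p) ρ) ∂gaussProd P
        = disorderAvg b v u fun ρ =>
          u * (F ρ * (replicaDiff m (v p) ρ * replicaDiff (m + 1) (v p) ρ)) := by
      intro p
      rw [integral_coord_mul_replicaAvg p hm (hF.mul_replicaDiff (v p))]
      congr 1
      funext ρ
      rcases hbv p with h | h
      · simp only [replicaDiff, h, zero_add]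
        have : ∑ l : Fin n, replicaCoeff (m + 1) l * (u * v p (ρ l))
            = u * ∑ l : Fin n, replicaCoeff (m + 1) l * v p (ρ l) := by
          rw [Finset.mul_sum]; exact Finset.sum_congr rfl fun l _ => by ring
        rw [this]; ring
      · simp [replicaDiff, h]
    rw [Finset.sum_congr rfl fun p _ => h2 p, ← disorderAvg_sum, ← disorderAvg_const_mul]
    congr 1
    funext ρ
    simp only [covObservable, Finset.mul_sum]
  · intro p _
    exact (integrable_eval_gaussProd p).mul_bdd
      (continuous_replicaAvg_tunedEnergy _).aestronglyMeasurable
      (Eventually.of_forall fun g => abs_replicaAvg_le _ _)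

end Disorder

/-! ### The abstract cavity computation -/

section Cavity

theorem le_add_of_hasDerivAt_mul_le {φ ψ : ℝ → ℝ} {M : ℝ}
    (hφ : ∀ u, HasDerivAt φ (u * ψ u) u) (hψ : ∀ u ∈ Set.Icc (0 : ℝ) 1, ψ u ≤ M)
    {u : ℝ} (hu : u ∈ Set.Icc (0 : ℝ) 1) : φ u ≤ φ 0 + M * u ^ 2 / 2 := by
  have hd : ∀ t, HasDerivAt (fun t => φ t - M * t ^ 2 / 2) (t * (ψ t - M)) t := by
    intro t
    refine ((hφ t).sub ((((hasDerivAt_id' t).fun_pow 2).const_mul M).div_const 2)).congr_deriv ?_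
    simp; ring
  have hanti : AntitoneOn (fun t => φ t - M * t ^ 2 / 2) (Set.Icc 0 1) := by
    refine antitoneOn_of_deriv_nonpos (convex_Icc 0 1)
      (fun t _ => (hd t).continuousAt.continuousWithinAt)
      (fun t _ => (hd t).differentiableAt.differentiableWithinAt) fun t ht => ?_
    rw [interior_Icc] at ht
    rw [(hd t).deriv]
    exact mul_nonpos_of_nonneg_of_nonpos ht.1.le (sub_nonpos.2 (hψ t ⟨ht.1.le, ht.2.le⟩))
  have := hanti (Set.left_mem_Icc.2 zero_le_one) hu hu.1
  simp only at this
  linarith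

theorem le_exp_mul_of_abs_deriv_le {φ ψ : ℝ → ℝ} {c : ℝ}
    (hφ : ∀ u, HasDerivAt φ (u * ψ u) u) (hψ : ∀ u, |ψ u| ≤ c * φ u)
    {u : ℝ} (hu : u ∈ Set.Icc (0 : ℝ) 1) (hpos : ∀ u, 0 ≤ φ u) (hc : 0 ≤ c) :
    φ u ≤ exp c * φ 1 := by
  have hd : ∀ t, HasDerivAt (fun t => exp (c * t) * φ t)
      (exp (c * t) * (c * φ t + t * ψ t)) t := by
    intro t
    refine ((((hasDerivAt_id' t).const_mul c).exp).mul (hφ t)).congr_deriv ?_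
    ring
  have hmono : MonotoneOn (fun t => exp (c * t) * φ t) (Set.Icc 0 1) := by
    refine monotoneOn_of_deriv_nonneg (convex_Icc 0 1)
      (fun t _ => (hd t).continuousAt.continuousWithinAt)
      (fun t _ => (hd t).differentiableAt.differentiableWithinAt) fun t ht => ?_
    rw [interior_Icc] at ht
    rw [(hd t).deriv]
    refine mul_nonneg (exp_pos _).le ?_
    have h1 := neg_le_of_abs_le (hψ t)
    have h2 := mul_nonneg hc (hpos t)
    nlinarith [ht.1, ht.2]
  have h1 := hmono hu (Set.right_mem_Icc.2 zero_le_one) hu.2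
  simp only [mul_one] at h1
  refine le_trans ?_ h1
  exact le_mul_of_one_le_left (hpos u) (one_le_exp (mul_nonneg hc hu.1))

/-- A finite Gaussian system with a distinguished spin `ε` that is coupled to the rest of the
system through the Gaussian part `v`, whose covariance is `ε ε x` up to a factor. -/
structure CavitySystem (S P : Type*) [Fintype P] where
  /-- energy coefficients not involving the distinguished spin -/
  b : P → S → ℝ
  /-- energy coefficients involving the distinguished spin -/
  v : P → S → ℝ
  /-- the distinguished spin -/
  ε : S → ℝ
  /-- the overlap of the remaining spins -/
  x : S → S → ℝ
  /-- flip of the distinguished spin -/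
  flip : Equiv.Perm S
  /-- covariance factor -/
  B : ℝ
  /-- self-overlap -/
  d : ℝ
  b_or_v : ∀ p, (∀ σ, b p σ = 0) ∨ ∀ σ, v p σ = 0
  ε_sq : ∀ σ, ε σ * ε σ = 1
  x_gram : IsGramKernel x
  x_abs : ∀ σ τ, |x σ τ| ≤ 1
  x_self : ∀ σ, x σ σ = d
  x_flip : ∀ σ τ, x (flip σ) τ = x σ τ
  ε_flip : ∀ σ, ε (flip σ) = -ε σ
  b_flip : ∀ p σ, b p (flip σ) = b p σ
  cov : ∀ σ τ, ∑ p, v p σ * v p τ = B * (ε σ * ε τ * x σ τ)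
  B_nonneg : 0 ≤ B
  B_le_one : B ≤ 1

namespace CavitySystem

variable {S P : Type*} [Fintype P] (C : CavitySystem S P)

theorem x_comm (σ τ : S) : C.x σ τ = C.x τ σ := by
  obtain ⟨k, φ, h⟩ := C.x_gram
  rw [h, h]
  exact Finset.sum_congr rfl fun a _ => mul_comm _ _

theorem x_flip_right (σ τ : S) : C.x σ (C.flip τ) = C.x σ τ := by
  rw [C.x_comm, C.x_flip, C.x_comm]

theorem ε_abs (σ : S) : |C.ε σ| = 1 := by
  have h := congrArg (fun t => |t|) (C.ε_sq σ)
  simp only [abs_mul, abs_one] at h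
  nlinarith [abs_nonneg (C.ε σ)]

/-- Integer coefficient of the pair of replicas `(k, l)` in the covariance observable. -/
def pairCoeff (m : ℕ) (k l : Fin 8) : ℤ :=
  if k = l then 0 else
    (if (k : ℕ) < m then 1 else if (k : ℕ) = m then -(m : ℤ) else 0) *
    (if (l : ℕ) < m + 1 then 1 else if (l : ℕ) = m + 1 then -((m : ℤ) + 1) else 0)

theorem covObservable_eq {m : ℕ} (hm : m < 8) (ρ : Fin 8 → S) :
    covObservable C.v m ρ = C.B * ∑ k, ∑ l, (pairCoeff m k l : ℝ) *
      (C.ε (ρ k) * C.ε (ρ l) * C.x (ρ k) (ρ l)) := by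
  have h1 : covObservable C.v m ρ = ∑ k : Fin 8, ∑ l : Fin 8,
      replicaCoeff m k * replicaCoeff (m + 1) l * (C.B *
        (C.ε (ρ k) * C.ε (ρ l) * C.x (ρ k) (ρ l))) := by
    simp only [covObservable, replicaDiff, Finset.sum_mul_sum]
    rw [Finset.sum_comm]
    refine Finset.sum_congr rfl fun k _ => ?_
    rw [Finset.sum_comm]
    refine Finset.sum_congr rfl fun l _ => ?_
    rw [← C.cov, Finset.mul_sum]
    exact Finset.sum_congr rfl fun p _ => by ring
  have h2 : ∀ k l : Fin 8, replicaCoeff m k * replicaCoeff (m + 1) l * (C.B *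
        (C.ε (ρ k) * C.ε (ρ l) * C.x (ρ k) (ρ l)))
      = C.B * ((pairCoeff m k l : ℝ) * (C.ε (ρ k) * C.ε (ρ l) * C.x (ρ k) (ρ l)))
        + if k = l then replicaCoeff m k * replicaCoeff (m + 1) k * (C.B * C.d) else 0 := by
    intro k l
    by_cases h : k = l
    · subst h
      simp [pairCoeff, C.ε_sq, C.x_self]
    · simp only [pairCoeff, h, if_false, replicaCoeff]
      push_cast
      ring
  simp only [h1, h2, Finset.sum_add_distrib, ← Finset.mul_sum, Finset.sum_ite_eq, mem_univ,
    if_true, ← Finset.sum_mul]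
  have h3 : ∑ k : Fin 8, replicaCoeff m k * replicaCoeff (m + 1) k = 0 := by
    rw [Fin.sum_univ_eq_sum_range (fun k => replicaCoeff m k * replicaCoeff (m + 1) k)]
    interval_cases m <;> norm_num [Finset.sum_range_succ, replicaCoeff]
  rw [h3]; ring

/-- Sum of the absolute overlaps of all pairs of distinct replicas. -/
def absSum (ρ : Fin 8 → S) : ℝ := ∑ k, ∑ l, if k = l then 0 else |C.x (ρ k) (ρ l)|

theorem absSum_nonneg (ρ : Fin 8 → S) : 0 ≤ C.absSum ρ :=
  Finset.sum_nonneg fun k _ => Finset.sum_nonneg fun l _ => by split_ifs <;> simp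

theorem abs_x_le_absSum (ρ : Fin 8 → S) : |C.x (ρ 0) (ρ 1)| ≤ C.absSum ρ := by
  have h0 : ∀ k l : Fin 8, 0 ≤ if k = l then 0 else |C.x (ρ k) (ρ l)| :=
    fun k l => by split_ifs <;> simp
  have h1 := Finset.single_le_sum (f := fun k : Fin 8 => ∑ l, if k = l then 0 else
    |C.x (ρ k) (ρ l)|) (fun k _ => Finset.sum_nonneg fun l _ => h0 k l) (mem_univ 0)
  have h2 := Finset.single_le_sum (f := fun l : Fin 8 => if (0 : Fin 8) = l then 0 else
    |C.x (ρ 0) (ρ l)|) (fun l _ => h0 0 l) (mem_univ 1)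
  exact (by simpa using h2 : |C.x (ρ 0) (ρ 1)| ≤ _).trans h1

theorem absSum_le (ρ : Fin 8 → S) : C.absSum ρ ≤ 64 := by
  calc C.absSum ρ ≤ ∑ _k : Fin 8, ∑ _l : Fin 8, (1 : ℝ) :=
        Finset.sum_le_sum fun k _ => Finset.sum_le_sum fun l _ => by
          split_ifs
          · simp
          · exact C.x_abs _ _
    _ = 64 := by norm_num

theorem abs_covObservable_le {m : ℕ} (hm : m ≤ 6) (ρ : Fin 8 → S) :
    |covObservable C.v m ρ| ≤ 64 * C.absSum ρ := by
  rw [C.covObservable_eq (by lia), abs_mul, abs_of_nonneg C.B_nonneg]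
  refine (mul_le_of_le_one_left (abs_nonneg _) C.B_le_one).trans ?_
  rw [absSum, Finset.mul_sum]
  refine (Finset.abs_sum_le_sum_abs _ _).trans (Finset.sum_le_sum fun k _ => ?_)
  rw [Finset.mul_sum]
  refine (Finset.abs_sum_le_sum_abs _ _).trans (Finset.sum_le_sum fun l _ => ?_)
  rw [abs_mul, abs_mul, abs_mul, C.ε_abs, C.ε_abs, one_mul, one_mul]
  by_cases h : k = l
  · simp [pairCoeff, h]
  · rw [if_neg h]
    refine mul_le_mul_of_nonneg_right ?_ (abs_nonneg _)
    have h1 : (pairCoeff m k l : ℝ) = replicaCoeff m k * replicaCoeff (m + 1) l := by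
      simp only [pairCoeff, h, if_false, replicaCoeff]
      push_cast
      ring
    rw [h1, abs_mul]
    have hm' : (m : ℝ) ≤ 6 := by exact_mod_cast hm
    have ha := abs_replicaCoeff_le (m := m) (l := k)
    have hb := abs_replicaCoeff_le (m := m + 1) (l := l)
    push_cast at hb
    nlinarith [abs_nonneg (replicaCoeff m k), abs_nonneg (replicaCoeff (m + 1) l)]

theorem dependsOnFirst_mul_covObservable {m : ℕ} {F : (Fin 8 → S) → ℝ}
    (hF : DependsOnFirst m F) :
    DependsOnFirst (m + 2) fun ρ => F ρ * covObservable C.v m ρ := by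
  have h : ∀ p, DependsOnFirst (m + 2) fun ρ =>
      F ρ * replicaDiff m (C.v p) ρ * replicaDiff (m + 1) (C.v p) ρ :=
    fun p => (hF.mul_replicaDiff (C.v p)).mul_replicaDiff (C.v p)
  intro ρ ρ' hρ
  simp only [covObservable, Finset.mul_sum, ← mul_assoc]
  exact Finset.sum_congr rfl fun p _ => h p ρ ρ' hρ

end CavitySystem
end Cavity

namespace CavitySystem

variable {S P : Type*} [Fintype P] (C : CavitySystem S P) [Fintype S] [Nonempty S]

/-- Disorder average of the cavity system with eight replicas. -/
abbrev avg (u : ℝ) (F : (Fin 8 → S) → ℝ) : ℝ := disorderAvg C.b C.v u F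

theorem avg_two (u : ℝ) (Φ : S → S → ℝ) {a b : Fin 8} (hab : a ≠ b) :
    C.avg u (fun ρ => Φ (ρ a) (ρ b)) = C.avg u (fun ρ => Φ (ρ 0) (ρ 1)) := by
  refine integral_congr_ae (Eventually.of_forall fun g => ?_)
  simp only
  rw [replicaAvg_two _ hab, replicaAvg_two _ (show (0 : Fin 8) ≠ 1 by decide)]

theorem avg_three (u : ℝ) (Φ : S → S → S → ℝ) {a b c : Fin 8} (hab : a ≠ b) (hac : a ≠ c)
    (hbc : b ≠ c) :
    C.avg u (fun ρ => Φ (ρ a) (ρ b) (ρ c)) = C.avg u (fun ρ => Φ (ρ 0) (ρ 1) (ρ 2)) := by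
  refine integral_congr_ae (Eventually.of_forall fun g => ?_)
  simp only
  rw [replicaAvg_three _ hab hac hbc, replicaAvg_three _ (show (0 : Fin 8) ≠ 1 by decide)
    (by decide) (by decide)]

theorem avg_zero_eq_zero_of_odd (r : Fin 8) {F : (Fin 8 → S) → ℝ}
    (h : ∀ ρ, F (Function.update ρ r (C.flip (ρ r))) = -F ρ) : C.avg 0 F = 0 := by
  have h1 := disorderAvg_update_symmetry (b := C.b) (v := C.v) C.flip C.b_flip r F
  simp only [h] at h1
  have h2 := disorderAvg_const_mul (b := C.b) (v := C.v) (u := 0) (-1) F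
  simp only [neg_mul, one_mul] at h2
  change disorderAvg C.b C.v 0 F = 0
  linarith

/-- Sign picked up by the spin of replica `k` when replica `r` is flipped. -/
def flipSign (r k : Fin 8) : ℤ := if k = r then -1 else 1

theorem ε_update (r k : Fin 8) (ρ : Fin 8 → S) :
    C.ε (Function.update ρ r (C.flip (ρ r)) k) = (flipSign r k : ℝ) * C.ε (ρ k) := by
  by_cases h : k = r
  · subst h; simp [flipSign, C.ε_flip]
  · simp [flipSign, h]

theorem x_update (r k l : Fin 8) (ρ : Fin 8 → S) :
    C.x (Function.update ρ r (C.flip (ρ r)) k) (Function.update ρ r (C.flip (ρ r)) l)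
      = C.x (ρ k) (ρ l) := by
  by_cases hk : k = r <;> by_cases hl : l = r
  · subst hk; subst hl; simp [C.x_flip, C.x_flip_right]
  · subst hk; simp [hl, C.x_flip]
  · subst hl; simp [hk, C.x_flip_right]
  · simp [hk, hl]

theorem avg_pow_le (j : ℕ) {u : ℝ} (hu : u ∈ Set.Icc (0 : ℝ) 1) :
    C.avg u (fun ρ => C.x (ρ 0) (ρ 1) ^ (2 * j))
      ≤ exp 4096 * C.avg 1 (fun ρ => C.x (ρ 0) (ρ 1) ^ (2 * j)) := by
  have hdep : DependsOnFirst 2 fun ρ : Fin 8 → S => C.x (ρ 0) (ρ 1) ^ (2 * j) := by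
    intro ρ ρ' h
    simp only [h 0 (by decide), h 1 (by decide)]
  have hnn : ∀ ρ : Fin 8 → S, 0 ≤ C.x (ρ 0) (ρ 1) ^ (2 * j) := fun ρ =>
    (even_two_mul j).pow_nonneg _
  refine le_exp_mul_of_abs_deriv_le
    (φ := fun u => C.avg u (fun ρ => C.x (ρ 0) (ρ 1) ^ (2 * j)))
    (fun u => hasDerivAt_disorderAvg C.b_or_v (by decide) hdep u) (fun u => ?_) hu
    (fun u => disorderAvg_nonneg hnn) (by norm_num)
  rw [← disorderAvg_const_mul]
  refine abs_disorderAvg_le fun ρ => ?_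
  rw [abs_mul, abs_of_nonneg (hnn ρ), mul_comm]
  refine mul_le_mul_of_nonneg_right ?_ (hnn ρ)
  have h1 := C.abs_covObservable_le (m := 2) (by decide) ρ
  have h2 := C.absSum_le ρ
  linarith

/-- Constant controlling the error terms in the cavity expansion. -/
def errConst (j : ℕ) : ℝ := 64 ^ (2 * j + 4) * exp 4096

theorem avg_absSum_pow_le (j : ℕ) {u : ℝ} (hu : u ∈ Set.Icc (0 : ℝ) 1) :
    C.avg u (fun ρ => C.absSum ρ ^ (2 * j + 4))
      ≤ errConst j * C.avg 1 (fun ρ => C.x (ρ 0) (ρ 1) ^ (2 * j + 4)) := by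
  have hpt : ∀ ρ : Fin 8 → S, C.absSum ρ ^ (2 * j + 4)
      ≤ 64 ^ (2 * j + 3) * ∑ k : Fin 8, ∑ l : Fin 8,
        if k = l then 0 else C.x (ρ k) (ρ l) ^ (2 * j + 4) := by
    intro ρ
    have h := pow_sum_div_card_le_sum_pow (s := (univ : Finset (Fin 8 × Fin 8)))
      (f := fun z => if z.1 = z.2 then 0 else |C.x (ρ z.1) (ρ z.2)|)
      (fun z _ => by split_ifs <;> simp) (2 * j + 3)
    rw [Fintype.sum_prod_type, Fintype.sum_prod_type, div_le_iff₀ (by simp)] at h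
    have hc : ((univ : Finset (Fin 8 × Fin 8)).card : ℝ) = 64 := by simp
    rw [hc] at h
    refine h.trans_eq ?_
    rw [mul_comm _ ((64 : ℝ) ^ (2 * j + 3))]
    congr 1
    refine Finset.sum_congr rfl fun k _ => Finset.sum_congr rfl fun l _ => ?_
    split_ifs
    · simp
    · exact Even.pow_abs ⟨j + 2, by ring⟩ _
  refine (disorderAvg_mono hpt).trans ?_
  rw [disorderAvg_const_mul, disorderAvg_sum]
  have hterm : ∀ k l : Fin 8, C.avg u (fun ρ => if k = l then 0 else
      C.x (ρ k) (ρ l) ^ (2 * j + 4))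
      ≤ exp 4096 * C.avg 1 (fun ρ => C.x (ρ 0) (ρ 1) ^ (2 * j + 4)) := by
    intro k l
    have hp := C.avg_pow_le (j + 2) hu
    have he : 2 * (j + 2) = 2 * j + 4 := by ring
    rw [he] at hp
    by_cases h : k = l
    · simp only [h, if_true, disorderAvg_const]
      have : 0 ≤ C.avg 1 (fun ρ => C.x (ρ 0) (ρ 1) ^ (2 * j + 4)) :=
        disorderAvg_nonneg fun ρ => Even.pow_nonneg ⟨j + 2, by ring⟩ _
      positivity
    · simp only [h, if_false]
      rw [C.avg_two u (fun a b => C.x a b ^ (2 * j + 4)) h]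
      exact hp
  have hs : ∑ k : Fin 8, C.avg u (fun ρ => ∑ l : Fin 8, if k = l then 0 else
      C.x (ρ k) (ρ l) ^ (2 * j + 4))
      ≤ 64 * (exp 4096 * C.avg 1 (fun ρ => C.x (ρ 0) (ρ 1) ^ (2 * j + 4))) := by
    calc _ ≤ ∑ _k : Fin 8, ∑ _l : Fin 8,
          exp 4096 * C.avg 1 (fun ρ => C.x (ρ 0) (ρ 1) ^ (2 * j + 4)) := by
          refine Finset.sum_le_sum fun k _ => ?_
          rw [avg, disorderAvg_sum]
          exact Finset.sum_le_sum fun l _ => hterm k l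
      _ = _ := by simp; ring
  calc _ ≤ 64 ^ (2 * j + 3) *
        (64 * (exp 4096 * C.avg 1 (fun ρ => C.x (ρ 0) (ρ 1) ^ (2 * j + 4)))) := by gcongr
    _ = _ := by rw [errConst]; ring

theorem abs_avg_le_of_abs_le (j : ℕ) {c : ℝ} (hc : 0 ≤ c) {F : (Fin 8 → S) → ℝ}
    (hF : ∀ ρ, |F ρ| ≤ c * C.absSum ρ ^ (2 * j + 4)) {u : ℝ} (hu : u ∈ Set.Icc (0 : ℝ) 1) :
    |C.avg u F| ≤ c * (errConst j * C.avg 1 (fun ρ => C.x (ρ 0) (ρ 1) ^ (2 * j + 4))) := by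
  refine (abs_disorderAvg_le hF).trans ?_
  rw [disorderAvg_const_mul]
  exact mul_le_mul_of_nonneg_left (C.avg_absSum_pow_le j hu) hc

end CavitySystem

namespace CavitySystem

/-- Pairs of replica pairs whose spins cancel against those of replicas `0` and `1`. -/
def Balanced (k l p q : Fin 8) : Prop :=
  ∀ r, flipSign r 0 * flipSign r 1 * (flipSign r k * flipSign r l)
    * (flipSign r p * flipSign r q) ≠ -1

instance (k l p q : Fin 8) : Decidable (Balanced k l p q) := by
  unfold Balanced; infer_instance

theorem balanced_cases : ∀ k l p q : Fin 8, k ≠ l → p ≠ q → Balanced k l p q →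
    ∃ a : Fin 8, a ≠ 0 ∧ a ≠ 1 ∧
      (((k = 0 ∧ l = a ∨ k = a ∧ l = 0) ∧ (p = 1 ∧ q = a ∨ p = a ∧ q = 1)) ∨
        ((k = 1 ∧ l = a ∨ k = a ∧ l = 1) ∧ (p = 0 ∧ q = a ∨ p = a ∧ q = 0))) := by
  decide +kernel

theorem sum_pairCoeff_balanced : ∑ p : Fin 8, ∑ q : Fin 8, ∑ k : Fin 8, ∑ l : Fin 8,
    pairCoeff 2 k l * pairCoeff 4 p q * (if Balanced k l p q then 1 else 0) = -16 := by
  decide +kernel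

/-- Replica pairs whose spins cancel against those of replicas `0` and `1`. -/
def PairBalanced (k l : Fin 8) : Prop :=
  ∀ r, flipSign r 0 * flipSign r 1 * (flipSign r k * flipSign r l) ≠ -1

instance (k l : Fin 8) : Decidable (PairBalanced k l) := by
  unfold PairBalanced; infer_instance

theorem pairBalanced_cases : ∀ k l : Fin 8, k ≠ l → PairBalanced k l →
    (k = 0 ∧ l = 1 ∨ k = 1 ∧ l = 0) := by
  decide +kernel

theorem sum_pairCoeff_pairBalanced : ∑ k : Fin 8, ∑ l : Fin 8,
    pairCoeff 2 k l * (if PairBalanced k l then 1 else 0) = 2 := by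
  decide +kernel

variable {S P : Type*} [Fintype P] (C : CavitySystem S P) [Fintype S] [Nonempty S]

theorem avg_zero_spin_mul_two (j : ℕ) (k l p q : Fin 8) (hkl : k ≠ l) (hpq : p ≠ q) :
    C.avg 0 (fun ρ => C.ε (ρ 0) * C.ε (ρ 1) * C.x (ρ 0) (ρ 1) ^ (2 * j + 1)
        * (C.ε (ρ k) * C.ε (ρ l) * C.x (ρ k) (ρ l)) * (C.ε (ρ p) * C.ε (ρ q) * C.x (ρ p) (ρ q)))
      = (if Balanced k l p q then (1 : ℤ) else 0 : ℤ) *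
        C.avg 0 (fun ρ => C.x (ρ 0) (ρ 1) ^ (2 * j + 1) * C.x (ρ 0) (ρ 2) * C.x (ρ 1) (ρ 2)) := by
  split_ifs with hb
  · obtain ⟨a, ha0, ha1, hcase⟩ := balanced_cases k l p q hkl hpq hb
    rw [← C.avg_three 0 (fun s t r => C.x s t ^ (2 * j + 1) * C.x s r * C.x t r)
      (show (0 : Fin 8) ≠ 1 by decide) ha0.symm ha1.symm]
    rw [Int.cast_one, one_mul]
    congr 1
    funext ρ
    have h0 := C.ε_sq (ρ 0)
    have h1 := C.ε_sq (ρ 1)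
    have ha := C.ε_sq (ρ a)
    have c0 := C.x_comm (ρ a) (ρ 0)
    have c1 := C.x_comm (ρ a) (ρ 1)
    rcases hcase with ⟨⟨rfl, rfl⟩ | ⟨rfl, rfl⟩, ⟨rfl, rfl⟩ | ⟨rfl, rfl⟩⟩ |
      ⟨⟨rfl, rfl⟩ | ⟨rfl, rfl⟩, ⟨rfl, rfl⟩ | ⟨rfl, rfl⟩⟩ <;>
    · try simp only [c0, c1]
      generalize C.ε (ρ 0) = e0 at *
      generalize C.ε (ρ 1) = e1 at *
      generalize C.ε (ρ _) = ea at *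
      generalize C.x (ρ 0) (ρ 1) ^ (2 * j + 1) = X at *
      generalize C.x (ρ 0) _ = Y at *
      generalize C.x (ρ 1) _ = Z at *
      linear_combination (e1 * e1 * ea * ea * X * Y * Z) * h0 + (ea * ea * X * Y * Z) * h1
        + X * Y * Z * ha
  · rw [Int.cast_zero, zero_mul]
    simp only [Balanced, not_forall, not_not] at hb
    obtain ⟨r, hr⟩ := hb
    refine C.avg_zero_eq_zero_of_odd r fun ρ => ?_
    have hr' : ((flipSign r 0 * flipSign r 1 * (flipSign r k * flipSign r l)
      * (flipSign r p * flipSign r q) : ℤ) : ℝ) = -1 := by rw [hr]; simp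
    push_cast at hr'
    simp only [C.ε_update, C.x_update]
    linear_combination (C.ε (ρ 0) * C.ε (ρ 1) * C.x (ρ 0) (ρ 1) ^ (2 * j + 1)
        * (C.ε (ρ k) * C.ε (ρ l) * C.x (ρ k) (ρ l)) *
        (C.ε (ρ p) * C.ε (ρ q) * C.x (ρ p) (ρ q))) * hr'

theorem avg_zero_spin_mul_one (j : ℕ) (k l : Fin 8) (hkl : k ≠ l) :
    C.avg 0 (fun ρ => C.ε (ρ 0) * C.ε (ρ 1) * C.x (ρ 0) (ρ 1) ^ (2 * j + 1)
        * (C.ε (ρ k) * C.ε (ρ l) * C.x (ρ k) (ρ l)))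
      = (if PairBalanced k l then (1 : ℤ) else 0 : ℤ) *
        C.avg 0 (fun ρ => C.x (ρ 0) (ρ 1) ^ (2 * j + 2)) := by
  split_ifs with hb
  · rw [Int.cast_one, one_mul]
    congr 1
    funext ρ
    have h0 := C.ε_sq (ρ 0)
    have h1 := C.ε_sq (ρ 1)
    have c0 := C.x_comm (ρ 1) (ρ 0)
    rcases pairBalanced_cases k l hkl hb with ⟨rfl, rfl⟩ | ⟨rfl, rfl⟩ <;>
    · try simp only [c0]
      linear_combination (C.ε (ρ 1) * C.ε (ρ 1) * C.x (ρ 0) (ρ 1) ^ (2 * j + 2)) * h0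
        + C.x (ρ 0) (ρ 1) ^ (2 * j + 2) * h1
  · rw [Int.cast_zero, zero_mul]
    simp only [PairBalanced, not_forall, not_not] at hb
    obtain ⟨r, hr⟩ := hb
    refine C.avg_zero_eq_zero_of_odd r fun ρ => ?_
    have hr' : ((flipSign r 0 * flipSign r 1 * (flipSign r k * flipSign r l) : ℤ) : ℝ) = -1 := by
      rw [hr]; simp
    push_cast at hr'
    simp only [C.ε_update, C.x_update]
    linear_combination (C.ε (ρ 0) * C.ε (ρ 1) * C.x (ρ 0) (ρ 1) ^ (2 * j + 1)
        * (C.ε (ρ k) * C.ε (ρ l) * C.x (ρ k) (ρ l))) * hr'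

theorem avg_zero_triple_nonneg (j : ℕ) :
    0 ≤ C.avg 0 (fun ρ => C.x (ρ 0) (ρ 1) ^ (2 * j + 1) * C.x (ρ 0) (ρ 2) * C.x (ρ 1) (ρ 2)) :=
  integral_nonneg fun g => (C.x_gram.pow (2 * j + 1)).replicaAvg_mul_nonneg _ C.x
    (by decide) (by decide) (by decide)

theorem avg_zero_spin_mul_cov_cov_nonpos (j : ℕ) :
    C.avg 0 (fun ρ => C.ε (ρ 0) * C.ε (ρ 1) * C.x (ρ 0) (ρ 1) ^ (2 * j + 1)
        * covObservable C.v 2 ρ * covObservable C.v 4 ρ) ≤ 0 := by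
  have h1 : ∀ ρ : Fin 8 → S, C.ε (ρ 0) * C.ε (ρ 1) * C.x (ρ 0) (ρ 1) ^ (2 * j + 1)
        * covObservable C.v 2 ρ * covObservable C.v 4 ρ
      = ∑ p, ∑ q, ∑ k, ∑ l, C.B ^ 2 * ((pairCoeff 2 k l * pairCoeff 4 p q : ℤ) : ℝ) *
        (C.ε (ρ 0) * C.ε (ρ 1) * C.x (ρ 0) (ρ 1) ^ (2 * j + 1)
        * (C.ε (ρ k) * C.ε (ρ l) * C.x (ρ k) (ρ l))
        * (C.ε (ρ p) * C.ε (ρ q) * C.x (ρ p) (ρ q))) := by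
    intro ρ
    rw [C.covObservable_eq (by decide), C.covObservable_eq (by decide)]
    simp only [Finset.mul_sum, Finset.sum_mul]
    refine Finset.sum_congr rfl fun p _ => Finset.sum_congr rfl fun q _ =>
      Finset.sum_congr rfl fun k _ => Finset.sum_congr rfl fun l _ => ?_
    push_cast
    ring
  simp only [h1, avg, disorderAvg_sum, disorderAvg_const_mul]
  set T := C.avg 0 (fun ρ => C.x (ρ 0) (ρ 1) ^ (2 * j + 1) * C.x (ρ 0) (ρ 2) * C.x (ρ 1) (ρ 2))
    with hT
  have h2 : ∀ k l p q : Fin 8, C.B ^ 2 * ((pairCoeff 2 k l * pairCoeff 4 p q : ℤ) : ℝ) *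
      disorderAvg C.b C.v 0 (fun ρ => C.ε (ρ 0) * C.ε (ρ 1) * C.x (ρ 0) (ρ 1) ^ (2 * j + 1)
        * (C.ε (ρ k) * C.ε (ρ l) * C.x (ρ k) (ρ l)) * (C.ε (ρ p) * C.ε (ρ q) * C.x (ρ p) (ρ q)))
      = C.B ^ 2 * T * ((pairCoeff 2 k l * pairCoeff 4 p q *
          (if Balanced k l p q then 1 else 0) : ℤ) : ℝ) := by
    intro k l p q
    by_cases hkl : k = l
    · simp [pairCoeff, hkl]
    by_cases hpq : p = q
    · simp [pairCoeff, hpq]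
    have := C.avg_zero_spin_mul_two j k l p q hkl hpq
    rw [avg] at this
    rw [this, Int.cast_mul (pairCoeff 2 k l * pairCoeff 4 p q)]
    ring
  simp only [h2, ← Finset.mul_sum, ← Int.cast_sum]
  rw [sum_pairCoeff_balanced]
  have hTn : 0 ≤ T := C.avg_zero_triple_nonneg j
  have : 0 ≤ C.B ^ 2 * T := mul_nonneg (sq_nonneg _) hTn
  push_cast
  linarith

theorem avg_zero_spin_mul_cov (j : ℕ) :
    C.avg 0 (fun ρ => C.ε (ρ 0) * C.ε (ρ 1) * C.x (ρ 0) (ρ 1) ^ (2 * j + 1)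
        * covObservable C.v 2 ρ)
      = 2 * C.B * C.avg 0 (fun ρ => C.x (ρ 0) (ρ 1) ^ (2 * j + 2)) := by
  have h1 : ∀ ρ : Fin 8 → S, C.ε (ρ 0) * C.ε (ρ 1) * C.x (ρ 0) (ρ 1) ^ (2 * j + 1)
        * covObservable C.v 2 ρ
      = ∑ k, ∑ l, C.B * ((pairCoeff 2 k l : ℤ) : ℝ) *
        (C.ε (ρ 0) * C.ε (ρ 1) * C.x (ρ 0) (ρ 1) ^ (2 * j + 1)
        * (C.ε (ρ k) * C.ε (ρ l) * C.x (ρ k) (ρ l))) := by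
    intro ρ
    rw [C.covObservable_eq (by decide)]
    simp only [Finset.mul_sum]
    refine Finset.sum_congr rfl fun k _ => Finset.sum_congr rfl fun l _ => ?_
    ring
  simp only [h1, avg, disorderAvg_sum, disorderAvg_const_mul]
  set T := C.avg 0 (fun ρ => C.x (ρ 0) (ρ 1) ^ (2 * j + 2)) with hT
  have h2 : ∀ k l : Fin 8, C.B * ((pairCoeff 2 k l : ℤ) : ℝ) *
      disorderAvg C.b C.v 0 (fun ρ => C.ε (ρ 0) * C.ε (ρ 1) * C.x (ρ 0) (ρ 1) ^ (2 * j + 1)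
        * (C.ε (ρ k) * C.ε (ρ l) * C.x (ρ k) (ρ l)))
      = C.B * T * ((pairCoeff 2 k l * (if PairBalanced k l then 1 else 0) : ℤ) : ℝ) := by
    intro k l
    by_cases hkl : k = l
    · simp [pairCoeff, hkl]
    have := C.avg_zero_spin_mul_one j k l hkl
    rw [avg] at this
    rw [this, Int.cast_mul (pairCoeff 2 k l)]
    ring
  simp only [h2, ← Finset.mul_sum, ← Int.cast_sum]
  rw [sum_pairCoeff_pairBalanced]
  push_cast
  ring

theorem avg_zero_spin (j : ℕ) :
    C.avg 0 (fun ρ => C.ε (ρ 0) * C.ε (ρ 1) * C.x (ρ 0) (ρ 1) ^ (2 * j + 1)) = 0 := by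
  refine C.avg_zero_eq_zero_of_odd 0 fun ρ => ?_
  simp only [C.ε_update, C.x_update]
  simp [flipSign]

theorem avg_zero_pow_mul_cov (j : ℕ) :
    C.avg 0 (fun ρ => C.x (ρ 0) (ρ 1) ^ (2 * j + 2) * covObservable C.v 2 ρ) = 0 := by
  have h1 : ∀ ρ : Fin 8 → S, C.x (ρ 0) (ρ 1) ^ (2 * j + 2) * covObservable C.v 2 ρ
      = ∑ k, ∑ l, C.B * ((pairCoeff 2 k l : ℤ) : ℝ) *
        (C.x (ρ 0) (ρ 1) ^ (2 * j + 2) * (C.ε (ρ k) * C.ε (ρ l) * C.x (ρ k) (ρ l))) := by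
    intro ρ
    rw [C.covObservable_eq (by decide)]
    simp only [Finset.mul_sum]
    refine Finset.sum_congr rfl fun k _ => Finset.sum_congr rfl fun l _ => ?_
    ring
  simp only [h1, avg, disorderAvg_sum, disorderAvg_const_mul]
  refine Finset.sum_eq_zero fun k _ => Finset.sum_eq_zero fun l _ => ?_
  by_cases hkl : k = l
  · simp [pairCoeff, hkl]
  · have := C.avg_zero_eq_zero_of_odd k (F := fun ρ => C.x (ρ 0) (ρ 1) ^ (2 * j + 2) *
      (C.ε (ρ k) * C.ε (ρ l) * C.x (ρ k) (ρ l))) fun ρ => by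
        simp only [C.ε_update, C.x_update]
        simp [flipSign, Ne.symm hkl]
    rw [avg] at this
    rw [this, mul_zero]

end CavitySystem

namespace CavitySystem

variable {S P : Type*} [Fintype P] (C : CavitySystem S P) [Fintype S] [Nonempty S]

/-- Constant in the second order cavity inequality. -/
def cavityConst (j : ℕ) : ℝ := 64 ^ 3 * errConst j

theorem abs_spin_mul_cov_le (j : ℕ) (ρ : Fin 8 → S) :
    |C.ε (ρ 0) * C.ε (ρ 1) * C.x (ρ 0) (ρ 1) ^ (2 * j + 1) * covObservable C.v 2 ρ
      * covObservable C.v 4 ρ * covObservable C.v 6 ρ| ≤ 64 ^ 3 * C.absSum ρ ^ (2 * j + 4) := by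
  simp only [abs_mul, abs_pow, C.ε_abs, one_mul]
  have hs := C.absSum_nonneg ρ
  calc _ ≤ C.absSum ρ ^ (2 * j + 1) * (64 * C.absSum ρ) * (64 * C.absSum ρ)
        * (64 * C.absSum ρ) := by
        gcongr
        · exact C.abs_x_le_absSum ρ
        · exact C.abs_covObservable_le (by decide) ρ
        · exact C.abs_covObservable_le (by decide) ρ
        · exact C.abs_covObservable_le (by decide) ρ
    _ = _ := by ring

theorem abs_pow_mul_cov_le (j : ℕ) (ρ : Fin 8 → S) :
    |C.x (ρ 0) (ρ 1) ^ (2 * j + 2) * covObservable C.v 2 ρ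
      * covObservable C.v 4 ρ| ≤ 64 ^ 2 * C.absSum ρ ^ (2 * j + 4) := by
  simp only [abs_mul, abs_pow]
  have hs := C.absSum_nonneg ρ
  calc _ ≤ C.absSum ρ ^ (2 * j + 2) * (64 * C.absSum ρ) * (64 * C.absSum ρ) := by
        gcongr
        · exact C.abs_x_le_absSum ρ
        · exact C.abs_covObservable_le (by decide) ρ
        · exact C.abs_covObservable_le (by decide) ρ
    _ = _ := by ring

/-- The overlap moment of the system without the distinguished spin is controlled by that of the
full system, up to a higher moment. -/
theorem avg_zero_pow_le (j : ℕ) :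
    C.avg 0 (fun ρ => C.x (ρ 0) (ρ 1) ^ (2 * j + 2))
      ≤ C.avg 1 (fun ρ => C.x (ρ 0) (ρ 1) ^ (2 * j + 2))
        + 64 ^ 2 * (errConst j * C.avg 1 (fun ρ => C.x (ρ 0) (ρ 1) ^ (2 * j + 4))) / 4 := by
  set M := 64 ^ 2 * (errConst j * C.avg 1 (fun ρ => C.x (ρ 0) (ρ 1) ^ (2 * j + 4))) with hM
  have hd2 : DependsOnFirst 2 fun ρ : Fin 8 → S => -C.x (ρ 0) (ρ 1) ^ (2 * j + 2) := by
    intro ρ ρ' h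
    simp only [h 0 (by decide), h 1 (by decide)]
  have hd4 := C.dependsOnFirst_mul_covObservable hd2
  have hneg : ∀ (u : ℝ) (F : (Fin 8 → S) → ℝ), C.avg u (fun ρ => -F ρ) = -C.avg u F := by
    intro u F
    have := disorderAvg_const_mul (b := C.b) (v := C.v) (u := u) (-1) F
    simpa only [neg_mul, one_mul] using this
  have hM4 : ∀ u ∈ Set.Icc (0 : ℝ) 1, C.avg u (fun ρ => -C.x (ρ 0) (ρ 1) ^ (2 * j + 2)
      * covObservable C.v 2 ρ * covObservable C.v 4 ρ) ≤ M := by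
    intro u hu
    refine (le_abs_self _).trans (C.abs_avg_le_of_abs_le j (by norm_num) (fun ρ => ?_) hu)
    rw [neg_mul, neg_mul, abs_neg]
    exact C.abs_pow_mul_cov_le j ρ
  have hM2 : ∀ u ∈ Set.Icc (0 : ℝ) 1, C.avg u (fun ρ => -C.x (ρ 0) (ρ 1) ^ (2 * j + 2)
      * covObservable C.v 2 ρ) ≤ M / 2 := by
    intro u hu
    have h := le_add_of_hasDerivAt_mul_le (fun u => hasDerivAt_disorderAvg C.b_or_v
      (show 4 + 1 < 8 by decide) hd4 u) hM4 hu
    have h0 : disorderAvg C.b C.v 0 (fun ρ : Fin 8 → S => -C.x (ρ 0) (ρ 1) ^ (2 * j + 2)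
      * covObservable C.v 2 ρ) = 0 := by
      have := hneg 0 (fun ρ => C.x (ρ 0) (ρ 1) ^ (2 * j + 2) * covObservable C.v 2 ρ)
      simp only [← neg_mul] at this
      rw [avg] at this
      rw [this, C.avg_zero_pow_mul_cov j, neg_zero]
    rw [h0, zero_add] at h
    have hMn : 0 ≤ M := (abs_nonneg _).trans (C.abs_avg_le_of_abs_le j (by norm_num)
      (C.abs_pow_mul_cov_le j) hu)
    refine h.trans ?_
    have : u ^ 2 ≤ 1 := pow_le_one₀ hu.1 hu.2
    nlinarith
  have h := le_add_of_hasDerivAt_mul_le (fun u => hasDerivAt_disorderAvg C.b_or_v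
      (show 2 + 1 < 8 by decide) hd2 u) hM2 (Set.right_mem_Icc.2 zero_le_one)
  have e1 := hneg 1 (fun ρ => C.x (ρ 0) (ρ 1) ^ (2 * j + 2))
  have e0 := hneg 0 (fun ρ => C.x (ρ 0) (ρ 1) ^ (2 * j + 2))
  rw [avg] at e0 e1
  rw [e0, e1] at h
  linarith

/-- Second order cavity inequality: the correlation of the distinguished spin with the overlap is
at most its first order value up to a higher moment of the overlap. -/
theorem avg_one_spin_le (j : ℕ) :
    C.avg 1 (fun ρ => C.ε (ρ 0) * C.ε (ρ 1) * C.x (ρ 0) (ρ 1) ^ (2 * j + 1))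
      ≤ C.B * C.avg 1 (fun ρ => C.x (ρ 0) (ρ 1) ^ (2 * j + 2))
        + cavityConst j * C.avg 1 (fun ρ => C.x (ρ 0) (ρ 1) ^ (2 * j + 4)) := by
  set A := errConst j * C.avg 1 (fun ρ => C.x (ρ 0) (ρ 1) ^ (2 * j + 4)) with hA
  have hA0 : 0 ≤ A := mul_nonneg (by rw [errConst]; positivity)
    (disorderAvg_nonneg fun ρ => Even.pow_nonneg ⟨j + 2, by ring⟩ _)
  have hd2 : DependsOnFirst 2 fun ρ : Fin 8 → S =>
      C.ε (ρ 0) * C.ε (ρ 1) * C.x (ρ 0) (ρ 1) ^ (2 * j + 1) := by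
    intro ρ ρ' h
    simp only [h 0 (by decide), h 1 (by decide)]
  have hd4 := C.dependsOnFirst_mul_covObservable hd2
  have hd6 := C.dependsOnFirst_mul_covObservable hd4
  have hM6 : ∀ u ∈ Set.Icc (0 : ℝ) 1, C.avg u (fun ρ =>
      C.ε (ρ 0) * C.ε (ρ 1) * C.x (ρ 0) (ρ 1) ^ (2 * j + 1)
      * covObservable C.v 2 ρ * covObservable C.v 4 ρ * covObservable C.v 6 ρ) ≤ 64 ^ 3 * A :=
    fun u hu => (le_abs_self _).trans
      (C.abs_avg_le_of_abs_le j (by norm_num) (C.abs_spin_mul_cov_le j) hu)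
  have hM4 : ∀ u ∈ Set.Icc (0 : ℝ) 1, C.avg u (fun ρ =>
      C.ε (ρ 0) * C.ε (ρ 1) * C.x (ρ 0) (ρ 1) ^ (2 * j + 1)
      * covObservable C.v 2 ρ * covObservable C.v 4 ρ) ≤ 64 ^ 3 * A / 2 := by
    intro u hu
    have h := le_add_of_hasDerivAt_mul_le (fun u => hasDerivAt_disorderAvg C.b_or_v
      (show 6 + 1 < 8 by decide) hd6 u) hM6 hu
    have h0 := C.avg_zero_spin_mul_cov_cov_nonpos j
    have : u ^ 2 ≤ 1 := pow_le_one₀ hu.1 hu.2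
    refine h.trans ?_
    nlinarith
  have hM2 : ∀ u ∈ Set.Icc (0 : ℝ) 1, C.avg u (fun ρ =>
      C.ε (ρ 0) * C.ε (ρ 1) * C.x (ρ 0) (ρ 1) ^ (2 * j + 1) * covObservable C.v 2 ρ)
      ≤ 2 * C.B * C.avg 0 (fun ρ => C.x (ρ 0) (ρ 1) ^ (2 * j + 2)) + 64 ^ 3 * A / 4 := by
    intro u hu
    have h := le_add_of_hasDerivAt_mul_le (fun u => hasDerivAt_disorderAvg C.b_or_v
      (show 4 + 1 < 8 by decide) hd4 u) hM4 hu
    have h0 := C.avg_zero_spin_mul_cov j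
    have : u ^ 2 ≤ 1 := pow_le_one₀ hu.1 hu.2
    refine h.trans ?_
    rw [avg] at h0
    rw [h0]
    nlinarith
  have h := le_add_of_hasDerivAt_mul_le (fun u => hasDerivAt_disorderAvg C.b_or_v
      (show 2 + 1 < 8 by decide) hd2 u) hM2 (Set.right_mem_Icc.2 zero_le_one)
  have h0 := C.avg_zero_spin j
  rw [avg] at h0
  rw [h0] at h
  have ha := C.avg_zero_pow_le j
  have hB0 := C.B_nonneg
  have hB1 := C.B_le_one
  have hBa := mul_le_mul_of_nonneg_left ha hB0
  have hBA : C.B * A ≤ A := mul_le_of_le_one_left hA0 hB1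
  have hc : cavityConst j * C.avg 1 (fun ρ => C.x (ρ 0) (ρ 1) ^ (2 * j + 4)) = 64 ^ 3 * A := by
    rw [hA, cavityConst]; ring
  rw [hc]
  rw [← hA] at hBa
  refine h.trans ?_
  linarith

end CavitySystem

/-! ### The Sherrington–Kirkpatrick model as a cavity system -/

section SK

theorem spin_mul_self (b : Bool) : spin b * spin b = 1 := by cases b <;> simp [spin]

theorem abs_spin (b : Bool) : |spin b| = 1 := by cases b <;> simp [spin]

theorem spin_not (b : Bool) : spin (!b) = -spin b := by cases b <;> simp [spin]

variable {N : ℕ}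

/-- Coefficient of the disorder variable `p` in the Hamiltonian. -/
def hamCoeff (N : ℕ) (β : ℝ) (p : Fin N × Fin N) (σ : Config N) : ℝ :=
  if p.1 < p.2 then β / √N * (spin (σ p.1) * spin (σ p.2)) else 0

theorem ham_eq_sum (β : ℝ) (g : Fin N × Fin N → ℝ) (σ : Config N) :
    ham N β g σ = ∑ p, g p * hamCoeff N β p σ := by
  rw [ham, Finset.mul_sum, Finset.sum_filter]
  refine Finset.sum_congr rfl fun p _ => ?_
  simp only [hamCoeff]
  split_ifs <;> ring

/-- Overlap of the sites different from `i`. -/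
def ovlpErase (N : ℕ) (i : Fin N) (σ τ : Config N) : ℝ :=
  (∑ j ∈ univ.erase i, spin (σ j) * spin (τ j)) / N

theorem ovlp_eq_add (i : Fin N) (σ τ : Config N) :
    ovlp N σ τ = ovlpErase N i σ τ + spin (σ i) * spin (τ i) / N := by
  rw [ovlp, ovlpErase, ← Finset.sum_erase_add _ _ (mem_univ i), add_div]

/-- Flip of the spin at the site `i`. -/
def flipSite (i : Fin N) : Equiv.Perm (Config N) :=
  Function.Involutive.toPerm (fun σ => Function.update σ i (!σ i)) fun σ => by simp

theorem flipSite_apply_of_ne {i j : Fin N} (h : j ≠ i) (σ : Config N) :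
    flipSite i σ j = σ j := by
  exact Function.update_of_ne h _ _

theorem flipSite_apply_self (i : Fin N) (σ : Config N) : flipSite i σ i = !σ i := by
  exact Function.update_self _ _ _

theorem sum_pairs_touching (i : Fin N) (w : Fin N → ℝ) :
    ∑ p : Fin N × Fin N, (if p.1 < p.2 ∧ (p.1 = i ∨ p.2 = i) then w p.1 * w p.2 else 0)
      = w i * ∑ j ∈ univ.erase i, w j := by
  have h : ∀ a b : Fin N, (if a < b ∧ (a = i ∨ b = i) then w a * w b else 0)
      = (if a = i then (if i < b then w i * w b else 0) else 0)
        + (if b = i then (if a < i then w i * w a else 0) else 0) := by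
    intro a b
    by_cases ha : a = i
    · subst ha
      by_cases hb : b = a
      · subst hb; simp
      · simp [hb]
    · by_cases hb : b = i
      · subst hb; simp [ha, mul_comm]
      · simp [ha, hb]
  rw [Fintype.sum_prod_type]
  simp only [h, Finset.sum_add_distrib, Finset.sum_ite_eq', mem_univ, if_true]
  rw [Finset.sum_comm]
  simp only [Finset.sum_ite_eq', mem_univ, if_true]
  rw [← Finset.sum_add_distrib, Finset.mul_sum, ← Finset.filter_ne', Finset.sum_filter]
  refine Finset.sum_congr rfl fun j _ => ?_
  rcases lt_trichotomy i j with h | h | h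
  · simp [h, h.not_gt, h.ne']
  · simp [h]
  · simp [h, h.not_gt, h.ne]

theorem isGramKernel_ovlpErase (i : Fin N) : IsGramKernel (ovlpErase N i) := by
  have h := IsGramKernel.of_fintype
    (fun (j : Fin N) (σ : Config N) => if j = i then 0 else spin (σ j) / √N)
  convert h using 3 with σ τ
  rw [ovlpErase, ← Finset.filter_ne', Finset.sum_filter, Finset.sum_div]
  refine Finset.sum_congr rfl fun j _ => ?_
  by_cases hj : j = i
  · simp [hj]
  · simp only [hj, ne_eq, not_false_eq_true, if_true, if_false]
    rw [div_mul_div_comm, Real.mul_self_sqrt (Nat.cast_nonneg N)]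

theorem abs_ovlpErase_le (i : Fin N) (σ τ : Config N) : |ovlpErase N i σ τ| ≤ 1 := by
  have hN : (0 : ℝ) < N := by exact_mod_cast i.pos
  rw [ovlpErase, abs_div, abs_of_pos hN, div_le_one hN]
  calc _ ≤ ∑ j ∈ univ.erase i, |spin (σ j) * spin (τ j)| := Finset.abs_sum_le_sum_abs _ _
    _ ≤ ∑ _j : Fin N, (1 : ℝ) := by
        refine (Finset.sum_le_sum (g := fun _ => (1 : ℝ)) fun j _ => ?_).trans
          (Finset.sum_le_sum_of_subset_of_nonneg (Finset.erase_subset _ _)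
            fun _ _ _ => zero_le_one)
        simp [abs_mul, abs_spin]
    _ = N := by simp

/-- The model at inverse temperature `β` with distinguished site `i`. -/
def skCavity {β : ℝ} (hβ : β ∈ Set.Ioo (0 : ℝ) 1) (i : Fin N) :
    CavitySystem (Config N) (Fin N × Fin N) where
  b p σ := if p.1 = i ∨ p.2 = i then 0 else hamCoeff N β p σ
  v p σ := if p.1 = i ∨ p.2 = i then hamCoeff N β p σ else 0
  ε σ := spin (σ i)
  x := ovlpErase N i
  flip := flipSite i
  B := β ^ 2
  d := ((N : ℝ) - 1) / N
  b_or_v p := by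
    by_cases h : p.1 = i ∨ p.2 = i
    · exact Or.inl fun σ => by simp [h]
    · exact Or.inr fun σ => by simp [h]
  ε_sq σ := spin_mul_self _
  x_gram := isGramKernel_ovlpErase i
  x_abs := abs_ovlpErase_le i
  x_self σ := by
    simp only [ovlpErase, spin_mul_self]
    rw [Finset.sum_const, Finset.card_erase_of_mem (mem_univ i)]
    simp [Nat.cast_sub (Nat.one_le_of_lt i.pos)]
  x_flip σ τ := by
    simp only [ovlpErase]
    congr 1
    refine Finset.sum_congr rfl fun j hj => ?_
    rw [flipSite_apply_of_ne (Finset.ne_of_mem_erase hj)]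
  ε_flip σ := by rw [flipSite_apply_self, spin_not]
  b_flip p σ := by
    by_cases h : p.1 = i ∨ p.2 = i
    · simp [h]
    · simp only [h, if_false, hamCoeff]
      rw [not_or] at h
      rw [flipSite_apply_of_ne h.1, flipSite_apply_of_ne h.2]
  cov σ τ := by
    have h := sum_pairs_touching i fun j => spin (σ j) * spin (τ j)
    have h1 : ∀ p : Fin N × Fin N, (if p.1 = i ∨ p.2 = i then hamCoeff N β p σ else 0)
        * (if p.1 = i ∨ p.2 = i then hamCoeff N β p τ else 0)
        = β ^ 2 / N * (if p.1 < p.2 ∧ (p.1 = i ∨ p.2 = i) then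
          (spin (σ p.1) * spin (τ p.1)) * (spin (σ p.2) * spin (τ p.2)) else 0) := by
      intro p
      have hs : (β / √N) * (β / √N) = β ^ 2 / N := by
        rw [div_mul_div_comm, Real.mul_self_sqrt (Nat.cast_nonneg N), sq]
      by_cases h1 : p.1 < p.2 <;> by_cases h2 : p.1 = i ∨ p.2 = i
      · simp only [hamCoeff, h1, h2, and_self, if_true]
        rw [← hs]; ring
      all_goals simp [hamCoeff, h1, h2]
    simp only [h1]
    rw [← Finset.mul_sum, h, ovlpErase]
    ring
  B_nonneg := sq_nonneg _
  B_le_one := pow_le_one₀ hβ.1.le hβ.2.le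

theorem tunedEnergy_skCavity {β : ℝ} (hβ : β ∈ Set.Ioo (0 : ℝ) 1) (i : Fin N)
    (g : Fin N × Fin N → ℝ) :
    tunedEnergy (skCavity hβ i).b (skCavity hβ i).v 1 g = ham N β g := by
  funext σ
  rw [ham_eq_sum, tunedEnergy]
  refine Finset.sum_congr rfl fun p _ => ?_
  simp only [skCavity]
  split_ifs <;> simp

theorem tunedEnergy_hamCoeff (β : ℝ) (g : Fin N × Fin N → ℝ) :
    tunedEnergy (hamCoeff N β) 0 1 g = ham N β g := by
  funext σ
  simp [ham_eq_sum, tunedEnergy]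

theorem gibbs2_eq_replicaAvg (β : ℝ) (g : Fin N × Fin N → ℝ) (f : Config N → Config N → ℝ) :
    gibbs2 N β g f = replicaAvg (n := 8) (ham N β g) fun ρ => f (ρ 0) (ρ 1) := by
  rw [replicaAvg_two _ (by decide), gibbs2, Finset.sum_div]
  refine Finset.sum_congr rfl fun σ _ => ?_
  rw [Finset.sum_div, Finset.mul_sum]
  refine Finset.sum_congr rfl fun τ _ => ?_
  rw [gibbsWeight, gibbsWeight, Real.exp_add]
  change _ = _ / partFun N β g * (_ / partFun N β g * _)
  ring

theorem Egibbs2_eq_disorderAvg (β : ℝ) (f : Config N → Config N → ℝ) :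
    Egibbs2 N β f = disorderAvg (n := 8) (hamCoeff N β) 0 1 fun ρ => f (ρ 0) (ρ 1) := by
  rw [Egibbs2, disorderAvg]
  simp only [tunedEnergy_hamCoeff, gibbs2_eq_replicaAvg]
  rfl

theorem Egibbs2_eq_avg {β : ℝ} (hβ : β ∈ Set.Ioo (0 : ℝ) 1) (i : Fin N)
    (f : Config N → Config N → ℝ) :
    Egibbs2 N β f = (skCavity hβ i).avg 1 fun ρ => f (ρ 0) (ρ 1) := by
  rw [Egibbs2_eq_disorderAvg, CavitySystem.avg, disorderAvg, disorderAvg]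
  simp only [tunedEnergy_hamCoeff, tunedEnergy_skCavity]

variable {β : ℝ} {f f' : Config N → Config N → ℝ}

theorem Egibbs2_mono (h : ∀ σ τ, f σ τ ≤ f' σ τ) : Egibbs2 N β f ≤ Egibbs2 N β f' := by
  rw [Egibbs2_eq_disorderAvg, Egibbs2_eq_disorderAvg]
  exact disorderAvg_mono fun ρ => h _ _

theorem Egibbs2_nonneg (h : ∀ σ τ, 0 ≤ f σ τ) : 0 ≤ Egibbs2 N β f := by
  rw [Egibbs2_eq_disorderAvg]
  exact disorderAvg_nonneg fun ρ => h _ _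

theorem Egibbs2_add (f f' : Config N → Config N → ℝ) :
    Egibbs2 N β (fun σ τ => f σ τ + f' σ τ) = Egibbs2 N β f + Egibbs2 N β f' := by
  simp only [Egibbs2_eq_disorderAvg]
  exact disorderAvg_add _ _

theorem Egibbs2_const_mul (c : ℝ) (f : Config N → Config N → ℝ) :
    Egibbs2 N β (fun σ τ => c * f σ τ) = c * Egibbs2 N β f := by
  simp only [Egibbs2_eq_disorderAvg]
  exact disorderAvg_const_mul _ _

theorem Egibbs2_const (c : ℝ) : Egibbs2 N β (fun _ _ => c) = c := by
  rw [Egibbs2_eq_disorderAvg, disorderAvg_const]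

theorem Egibbs2_sum {ι : Type*} (s : Finset ι) (f : ι → Config N → Config N → ℝ) :
    Egibbs2 N β (fun σ τ => ∑ a ∈ s, f a σ τ) = ∑ a ∈ s, Egibbs2 N β (f a) := by
  simp only [Egibbs2_eq_disorderAvg]
  exact disorderAvg_sum _ _

end SK

section SKMoments

theorem add_mul_le_pow_even (j : ℕ) (x h : ℝ) :
    x ^ (2 * j) + 2 * j * (h * x ^ (2 * j - 1)) ≤ (x + h) ^ (2 * j) := by
  rcases Nat.eq_zero_or_pos j with rfl | hj
  · simp
  rcases eq_or_ne x 0 with rfl | hx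
  · rw [zero_pow (by lia), zero_pow (by lia), zero_add, mul_zero, mul_zero, zero_add]
    exact (even_two_mul j).pow_nonneg _
  have key : 1 + (2 * j : ℕ) * (h / x) ≤ (1 + h / x) ^ (2 * j) := by
    rcases le_total (-2) (h / x) with h2 | h2
    · exact one_add_mul_le_pow h2 _
    · have h3 : 0 ≤ (1 + h / x) ^ (2 * j) := (even_two_mul j).pow_nonneg _
      have h4 : (1 : ℝ) ≤ (2 * j : ℕ) := by exact_mod_cast (by lia : 1 ≤ 2 * j)
      nlinarith
  have h5 := mul_le_mul_of_nonneg_left key ((even_two_mul j).pow_nonneg x)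
  rw [← mul_pow] at h5
  have e1 : x * (1 + h / x) = x + h := by field_simp
  have e2 : x ^ (2 * j) = x ^ (2 * j - 1) * x := by
    rw [← pow_succ]; congr 1; lia
  rw [e1] at h5
  refine le_trans (le_of_eq ?_) h5
  rw [e2]
  push_cast
  field_simp

variable {N : ℕ} {β : ℝ}

/-- Even moments of the overlap. -/
def overlapMoment (N : ℕ) (β : ℝ) (k : ℕ) : ℝ := Egibbs2 N β fun σ τ => ovlp N σ τ ^ (2 * k)

theorem overlapMoment_zero : overlapMoment N β 0 = 1 := by
  simp [overlapMoment, Egibbs2_const]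

theorem Egibbs2_spin_mul_pow_nonneg (hβ : β ∈ Set.Ioo (0 : ℝ) 1) (i : Fin N) (m : ℕ) :
    0 ≤ Egibbs2 N β fun σ τ => spin (σ i) * spin (τ i) * ovlpErase N i σ τ ^ m := by
  rw [Egibbs2_eq_avg hβ i]
  exact integral_nonneg fun g => ((IsGramKernel.rankOne fun σ : Config N => spin (σ i)).mul
    ((isGramKernel_ovlpErase i).pow m)).replicaAvg_nonneg _ (by decide)

theorem Egibbs2_ovlpErase_pow_le (hβ : β ∈ Set.Ioo (0 : ℝ) 1) (i : Fin N) (k : ℕ) :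
    (Egibbs2 N β fun σ τ => ovlpErase N i σ τ ^ (2 * k)) ≤ overlapMoment N β k := by
  have h : ∀ σ τ : Config N, ovlpErase N i σ τ ^ (2 * k) + 2 * k / N *
      (spin (σ i) * spin (τ i) * ovlpErase N i σ τ ^ (2 * k - 1)) ≤ ovlp N σ τ ^ (2 * k) := by
    intro σ τ
    rw [ovlp_eq_add i]
    refine le_trans (le_of_eq ?_) (add_mul_le_pow_even k _ _)
    ring
  have h1 := Egibbs2_mono (β := β) h
  rw [Egibbs2_add, Egibbs2_const_mul] at h1
  have h2 := Egibbs2_spin_mul_pow_nonneg hβ i (2 * k - 1)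
  have h3 : (0 : ℝ) ≤ 2 * k / N := by positivity
  have := mul_nonneg h3 h2
  rw [overlapMoment]
  linarith

theorem Egibbs2_spin_mul_pow_le (hβ : β ∈ Set.Ioo (0 : ℝ) 1) (i : Fin N) (j : ℕ) :
    (Egibbs2 N β fun σ τ => spin (σ i) * spin (τ i) * ovlpErase N i σ τ ^ (2 * j + 1))
      ≤ β ^ 2 * overlapMoment N β (j + 1)
        + CavitySystem.cavityConst j * overlapMoment N β (j + 2) := by
  have h := (skCavity hβ i).avg_one_spin_le j
  have e0 := Egibbs2_eq_avg hβ i fun σ τ => spin (σ i) * spin (τ i) *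
    ovlpErase N i σ τ ^ (2 * j + 1)
  have e1 := Egibbs2_eq_avg hβ i fun σ τ => ovlpErase N i σ τ ^ (2 * j + 2)
  have e2 := Egibbs2_eq_avg hβ i fun σ τ => ovlpErase N i σ τ ^ (2 * j + 4)
  have h1 := Egibbs2_ovlpErase_pow_le hβ i (j + 1)
  have h2 := Egibbs2_ovlpErase_pow_le hβ i (j + 2)
  have hc : 0 ≤ CavitySystem.cavityConst j := by
    rw [CavitySystem.cavityConst, CavitySystem.errConst]; positivity
  rw [e0]
  refine h.trans (add_le_add ?_ ?_)
  · exact mul_le_mul_of_nonneg_left (e1.symm.trans_le h1) (sq_nonneg β)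
  · exact mul_le_mul_of_nonneg_left (e2.symm.trans_le h2) hc

theorem spin_mul_ovlp_pow_le (i : Fin N) (j : ℕ) (σ τ : Config N) :
    spin (σ i) * spin (τ i) * ovlp N σ τ ^ (2 * j + 1)
      ≤ spin (σ i) * spin (τ i) * ovlpErase N i σ τ ^ (2 * j + 1)
        + (2 * j + 1) / N * (ovlp N σ τ ^ (2 * j) + ovlpErase N i σ τ ^ (2 * j)) := by
  have hN : (0 : ℝ) < N := by exact_mod_cast i.pos
  set R := ovlp N σ τ
  set x := ovlpErase N i σ τ
  have h1 : |R - x| = 1 / N := by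
    have : R - x = spin (σ i) * spin (τ i) / N := by
      simp only [R, x, ovlp_eq_add i]; ring
    rw [this, abs_div, abs_mul, abs_spin, abs_spin, abs_of_pos hN, one_mul]
  have h2 := abs_pow_sub_pow_le R x (2 * j + 1)
  rw [h1, Nat.add_sub_cancel] at h2
  have h3 : max |R| |x| ^ (2 * j) ≤ R ^ (2 * j) + x ^ (2 * j) := by
    have hR : 0 ≤ R ^ (2 * j) := (even_two_mul j).pow_nonneg _
    have hx : 0 ≤ x ^ (2 * j) := (even_two_mul j).pow_nonneg _
    rcases max_cases |R| |x| with h | h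
    · rw [h.1, (even_two_mul j).pow_abs]; linarith
    · rw [h.1, (even_two_mul j).pow_abs]; linarith
  have h4 : spin (σ i) * spin (τ i) * (R ^ (2 * j + 1) - x ^ (2 * j + 1))
      ≤ |R ^ (2 * j + 1) - x ^ (2 * j + 1)| := by
    refine (le_abs_self _).trans ?_
    rw [abs_mul, abs_mul, abs_spin, abs_spin, one_mul, one_mul]
  have h5 : 1 / (N : ℝ) * ((2 * j + 1 : ℕ) : ℝ) * max |R| |x| ^ (2 * j)
      ≤ (2 * j + 1) / N * (R ^ (2 * j) + x ^ (2 * j)) := by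
    have : 1 / (N : ℝ) * ((2 * j + 1 : ℕ) : ℝ) = (2 * j + 1) / N := by push_cast; ring
    rw [this]
    exact mul_le_mul_of_nonneg_left h3 (by positivity)
  linarith

/-- The recursive inequality between three consecutive even overlap moments. -/
theorem overlapMoment_recursion (hβ : β ∈ Set.Ioo (0 : ℝ) 1) (hN : 1 ≤ N) (j : ℕ) :
    (1 - β ^ 2) * overlapMoment N β (j + 1)
      ≤ 2 * (2 * j + 1) / N * overlapMoment N β j
        + CavitySystem.cavityConst j * overlapMoment N β (j + 2) := by
  have hN0 : (0 : ℝ) < N := by exact_mod_cast hN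
  have hsum : overlapMoment N β (j + 1) = 1 / N * ∑ i : Fin N, Egibbs2 N β fun σ τ =>
      spin (σ i) * spin (τ i) * ovlp N σ τ ^ (2 * j + 1) := by
    rw [← Egibbs2_sum, ← Egibbs2_const_mul, overlapMoment]
    congr 1
    funext σ τ
    rw [← Finset.sum_mul, show 2 * (j + 1) = (2 * j + 1) + 1 by ring, pow_succ']
    simp only [ovlp]
    ring
  have hi : ∀ i : Fin N, (Egibbs2 N β fun σ τ =>
      spin (σ i) * spin (τ i) * ovlp N σ τ ^ (2 * j + 1))
      ≤ β ^ 2 * overlapMoment N β (j + 1)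
        + CavitySystem.cavityConst j * overlapMoment N β (j + 2)
        + (2 * j + 1) / N * (2 * overlapMoment N β j) := by
    intro i
    refine (Egibbs2_mono (spin_mul_ovlp_pow_le i j)).trans ?_
    rw [Egibbs2_add, Egibbs2_const_mul, Egibbs2_add]
    refine add_le_add (Egibbs2_spin_mul_pow_le hβ i j) ?_
    refine mul_le_mul_of_nonneg_left ?_ (by positivity)
    have := Egibbs2_ovlpErase_pow_le hβ i j
    rw [two_mul (overlapMoment N β j)]
    exact add_le_add le_rfl this
  have h1 := Finset.sum_le_sum fun i (_ : i ∈ (univ : Finset (Fin N))) => hi i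
  rw [Finset.sum_const, card_univ, Fintype.card_fin, nsmul_eq_mul] at h1
  have h2 := mul_le_mul_of_nonneg_left h1 (show (0 : ℝ) ≤ 1 / N by positivity)
  rw [← hsum, ← mul_assoc, one_div_mul_cancel hN0.ne', one_mul] at h2
  have e : (2 * j + 1) / (N : ℝ) * (2 * overlapMoment N β j)
      = 2 * (2 * j + 1) / N * overlapMoment N β j := by ring
  rw [e] at h2
  linarith

end SKMoments

/-! ### Annealed estimates -/

section Annealed

variable {N : ℕ} {β : ℝ}

theorem two_mul_sum_lt_add_sum_sq (w : Fin N → ℝ) :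
    2 * (∑ p : Fin N × Fin N, if p.1 < p.2 then w p.1 * w p.2 else 0) + ∑ a, w a ^ 2
      = (∑ a, w a) ^ 2 := by
  have h : ∀ a b : Fin N, w a * w b = (if a < b then w a * w b else 0)
      + (if b < a then w b * w a else 0) + (if a = b then w a ^ 2 else 0) := by
    intro a b
    rcases lt_trichotomy a b with h | h | h
    · simp [h, h.not_gt, h.ne]
    · simp [h, sq]
    · simp [h, h.not_gt, h.ne', mul_comm]
  rw [sq (∑ a, w a), Finset.sum_mul_sum, Fintype.sum_prod_type]
  rw [Finset.sum_congr rfl fun a (_ : a ∈ univ) => Finset.sum_congr rfl fun b (_ : b ∈ univ) =>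
    h a b]
  simp only [Finset.sum_add_distrib]
  rw [Finset.sum_comm (f := fun a b : Fin N => if b < a then w b * w a else 0)]
  simp only [Finset.sum_ite_eq, mem_univ, if_true]
  ring

theorem sum_hamCoeff_mul (hN : 1 ≤ N) (σ τ : Config N) :
    ∑ p, hamCoeff N β p σ * hamCoeff N β p τ = β ^ 2 / 2 * (N * ovlp N σ τ ^ 2 - 1) := by
  have hN0 : (N : ℝ) ≠ 0 := by positivity
  have h := two_mul_sum_lt_add_sum_sq fun a => spin (σ a) * spin (τ a)
  have hs : (β / √N) * (β / √N) = β ^ 2 / N := by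
    rw [div_mul_div_comm, Real.mul_self_sqrt (Nat.cast_nonneg N), sq]
  have h1 : ∀ p : Fin N × Fin N, hamCoeff N β p σ * hamCoeff N β p τ = β ^ 2 / N *
      (if p.1 < p.2 then spin (σ p.1) * spin (τ p.1) * (spin (σ p.2) * spin (τ p.2)) else 0) := by
    intro p
    simp only [hamCoeff]
    split_ifs
    · rw [← hs]; ring
    · simp
  have h2 : ∑ a : Fin N, (spin (σ a) * spin (τ a)) ^ 2 = N := by
    have hq : ∀ a : Fin N, (spin (σ a) * spin (τ a)) ^ 2 = 1 := fun a => by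
      rw [mul_pow, sq, sq, spin_mul_self, spin_mul_self, one_mul]
    simp [hq]
  simp only [h1]
  rw [← Finset.mul_sum]
  rw [h2] at h
  have h3 : (∑ p : Fin N × Fin N, if p.1 < p.2 then
      spin (σ p.1) * spin (τ p.1) * (spin (σ p.2) * spin (τ p.2)) else 0)
      = ((∑ a, spin (σ a) * spin (τ a)) ^ 2 - N) / 2 := by linarith
  rw [h3, ovlp]
  field_simp

theorem ovlp_self (hN : 1 ≤ N) (σ : Config N) : ovlp N σ σ = 1 := by
  have hN0 : (N : ℝ) ≠ 0 := by positivity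
  simp [ovlp, spin_mul_self, hN0]

theorem abs_ovlp_le (σ τ : Config N) : |ovlp N σ τ| ≤ 1 := by
  rw [ovlp, abs_div, Nat.abs_cast]
  refine div_le_one_of_le₀ ?_ (Nat.cast_nonneg N)
  refine (Finset.abs_sum_le_sum_abs _ _).trans ?_
  simp [abs_mul, abs_spin]

/-- Disorder expectation of the partition function. -/
def annealedPartFun (N : ℕ) (β : ℝ) : ℝ := 2 ^ N * exp (β ^ 2 * (N - 1) / 4)

theorem annealedPartFun_pos : 0 < annealedPartFun N β := by
  unfold annealedPartFun; positivity

theorem partFun_pos (g : Fin N × Fin N → ℝ) : 0 < partFun N β g :=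
  sum_exp_pos _

theorem integrable_exp_ham (σ : Config N) :
    Integrable (fun g => exp (ham N β g σ)) (gaussPi N) := by
  simp only [ham_eq_sum]
  exact integrable_exp_linear_gaussProd _

theorem integral_partFun (hN : 1 ≤ N) : ∫ g, partFun N β g ∂gaussPi N = annealedPartFun N β := by
  simp only [partFun]
  rw [integral_finsetSum _ fun σ _ => integrable_exp_ham σ]
  have h : ∀ σ : Config N, ∫ g, exp (ham N β g σ) ∂gaussPi N = exp (β ^ 2 * (N - 1) / 4) := by
    intro σ
    simp only [ham_eq_sum]
    refine (integral_exp_linear_gaussProd _).trans ?_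
    simp only [sq (hamCoeff N β _ σ)]
    rw [sum_hamCoeff_mul hN, ovlp_self hN]
    congr 1; ring
  simp [h, annealedPartFun]

theorem ham_add_ham (g : Fin N × Fin N → ℝ) (σ τ : Config N) :
    ham N β g σ + ham N β g τ = ∑ p, g p * (hamCoeff N β p σ + hamCoeff N β p τ) := by
  rw [ham_eq_sum, ham_eq_sum, ← Finset.sum_add_distrib]
  exact Finset.sum_congr rfl fun p _ => by ring

theorem integrable_exp_ham_add (σ τ : Config N) :
    Integrable (fun g => exp (ham N β g σ + ham N β g τ)) (gaussPi N) := by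
  simp only [ham_add_ham]
  exact integrable_exp_linear_gaussProd _

theorem integral_exp_ham_add_le (hN : 1 ≤ N) (σ τ : Config N) :
    ∫ g, exp (ham N β g σ + ham N β g τ) ∂gaussPi N
      ≤ annealedPartFun N β ^ 2 / 4 ^ N * exp (β ^ 2 * (N * ovlp N σ τ ^ 2) / 2) := by
  simp only [ham_add_ham]
  refine (integral_exp_linear_gaussProd _).trans_le ?_
  have h : ∑ p, (hamCoeff N β p σ + hamCoeff N β p τ) ^ 2
      = β ^ 2 * (N - 1) + β ^ 2 * (N * ovlp N σ τ ^ 2 - 1) := by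
    have h1 := sum_hamCoeff_mul (β := β) hN σ σ
    have h2 := sum_hamCoeff_mul (β := β) hN τ τ
    have h3 := sum_hamCoeff_mul (β := β) hN σ τ
    rw [ovlp_self hN] at h1 h2
    have : ∑ p, (hamCoeff N β p σ + hamCoeff N β p τ) ^ 2
        = ∑ p, hamCoeff N β p σ * hamCoeff N β p σ + ∑ p, hamCoeff N β p τ * hamCoeff N β p τ
          + 2 * ∑ p, hamCoeff N β p σ * hamCoeff N β p τ := by
      rw [Finset.mul_sum, ← Finset.sum_add_distrib, ← Finset.sum_add_distrib]
      exact Finset.sum_congr rfl fun p _ => by ring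
    rw [this, h1, h2, h3]; ring
  have e : annealedPartFun N β ^ 2 / 4 ^ N = exp (β ^ 2 * (N - 1) / 2) := by
    rw [annealedPartFun, mul_pow, ← pow_mul, mul_comm N 2, pow_mul, ← Real.exp_nat_mul,
      show (2 : ℝ) ^ 2 = 4 by norm_num, mul_div_cancel_left₀ _ (by positivity)]
    congr 1; push_cast; ring
  rw [h, e, ← Real.exp_add, Real.exp_le_exp]
  nlinarith [sq_nonneg β]

theorem sum_exp_mul_spin (c : ℝ) (σ : Config N) :
    ∑ τ : Config N, exp (c * ∑ i, spin (σ i) * spin (τ i)) = (2 * cosh c) ^ N := by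
  have h1 : ∀ τ : Config N, exp (c * ∑ i, spin (σ i) * spin (τ i))
      = ∏ i, exp (c * (spin (σ i) * spin (τ i))) := by
    intro τ; rw [Finset.mul_sum, Real.exp_sum]
  have h2 : ∀ i, ∑ b : Bool, exp (c * (spin (σ i) * spin b)) = 2 * cosh c := by
    intro i
    rw [Fintype.sum_bool, Real.cosh_eq]
    cases σ i <;> simp [spin] <;> ring
  simp only [h1]
  have h3 := Finset.prod_univ_sum (fun _ : Fin N => (univ : Finset Bool))
    fun i b => exp (c * (spin (σ i) * spin b))
  rw [Fintype.piFinset_univ] at h3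
  rw [← h3]
  simp only [h2, Finset.prod_const, card_univ, Fintype.card_fin]

theorem exists_int_overlap (σ τ : Config N) :
    ∃ m ∈ Finset.Icc (-(N : ℤ)) N, ∑ i, spin (σ i) * spin (τ i) = (m : ℝ) := by
  have hs : ∀ b, spin b = ((if b then 1 else -1 : ℤ) : ℝ) := by
    intro b; cases b <;> simp [spin]
  refine ⟨∑ i, (if σ i then 1 else -1) * (if τ i then 1 else -1), ?_, ?_⟩
  · have h : |∑ i, (if σ i then 1 else -1) * (if τ i then 1 else -1 : ℤ)| ≤ N := by
      refine (Finset.abs_sum_le_sum_abs _ _).trans ?_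
      refine (Finset.sum_le_sum (g := fun _ => (1 : ℤ)) fun i _ => ?_).trans (by simp)
      split_ifs <;> simp
    rw [Finset.mem_Icc]
    exact abs_le.1 h
  · simp only [hs]
    push_cast
    rfl

theorem sum_exp_overlap_sq_le (hN : 1 ≤ N) :
    ∑ σ : Config N, ∑ τ : Config N, exp (N * ovlp N σ τ ^ 2 / 2) ≤ (2 * N + 1) * 4 ^ N := by
  have hN0 : (0 : ℝ) < N := by exact_mod_cast hN
  have h1 : ∀ σ τ : Config N, exp (N * ovlp N σ τ ^ 2 / 2)
      ≤ ∑ m ∈ Finset.Icc (-(N : ℤ)) N, exp (-((m : ℝ) ^ 2 / (2 * N))) *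
        exp (m / N * ∑ i, spin (σ i) * spin (τ i)) := by
    intro σ τ
    obtain ⟨m, hm, h⟩ := exists_int_overlap σ τ
    refine le_trans (le_of_eq ?_) (Finset.single_le_sum (fun m _ => by positivity) hm)
    rw [← Real.exp_add, ovlp, h]
    congr 1
    field_simp
    ring
  calc _ ≤ ∑ σ : Config N, ∑ τ : Config N, ∑ m ∈ Finset.Icc (-(N : ℤ)) N,
        exp (-((m : ℝ) ^ 2 / (2 * N))) * exp (m / N * ∑ i, spin (σ i) * spin (τ i)) :=
        Finset.sum_le_sum fun σ _ => Finset.sum_le_sum fun τ _ => h1 σ τ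
    _ = ∑ m ∈ Finset.Icc (-(N : ℤ)) N, ∑ σ : Config N,
        exp (-((m : ℝ) ^ 2 / (2 * N))) * (2 * cosh (m / N)) ^ N := by
        rw [Finset.sum_comm (s := Finset.Icc (-(N : ℤ)) N)]
        refine Finset.sum_congr rfl fun σ _ => ?_
        rw [Finset.sum_comm]
        refine Finset.sum_congr rfl fun m _ => ?_
        rw [← Finset.mul_sum, sum_exp_mul_spin]
    _ ≤ ∑ _m ∈ Finset.Icc (-(N : ℤ)) N, ∑ _σ : Config N, (2 : ℝ) ^ N := by
        refine Finset.sum_le_sum fun m _ => Finset.sum_le_sum fun σ _ => ?_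
        have h2 : cosh ((m : ℝ) / N) ≤ exp (((m : ℝ) / N) ^ 2 / 2) := Real.cosh_le_exp_half_sq _
        calc _ ≤ exp (-((m : ℝ) ^ 2 / (2 * N))) * (2 * exp (((m : ℝ) / N) ^ 2 / 2)) ^ N := by
              have := (Real.cosh_pos ((m : ℝ) / N)).le
              gcongr
          _ = 2 ^ N := by
              rw [mul_pow, ← Real.exp_nat_mul, mul_left_comm, ← Real.exp_add]
              have : -((m : ℝ) ^ 2 / (2 * N)) + N * (((m : ℝ) / N) ^ 2 / 2) = 0 := by
                field_simp; ring
              rw [this, Real.exp_zero, mul_one]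
    _ = _ := by
        have hc : (((N : ℤ) + 1 - -(N : ℤ)).toNat : ℝ) = 2 * N + 1 := by
          have : ((N : ℤ) + 1 - -(N : ℤ)).toNat = 2 * N + 1 := by lia
          rw [this]; push_cast; ring
        simp only [Finset.sum_const, Int.card_Icc, nsmul_eq_mul, hc]
        have h4 : (4 : ℝ) ^ N = 2 ^ N * 2 ^ N := by rw [← mul_pow]; norm_num
        rw [h4]
        simp

/-- Unnormalized two-replica average of the exponential overlap weight. -/
def overlapWeightSum (N : ℕ) (β : ℝ) (g : Fin N × Fin N → ℝ) : ℝ :=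
  ∑ σ : Config N, ∑ τ : Config N,
    exp (N * (1 - β ^ 2) * ovlp N σ τ ^ 2 / 2) * exp (ham N β g σ + ham N β g τ)

theorem integrable_overlapWeightSum : Integrable (overlapWeightSum N β) (gaussPi N) := by
  unfold overlapWeightSum
  exact integrable_finsetSum _ fun σ _ => integrable_finsetSum _ fun τ _ =>
    (integrable_exp_ham_add σ τ).const_mul _

theorem integral_overlapWeightSum_le (hN : 1 ≤ N) :
    ∫ g, overlapWeightSum N β g ∂gaussPi N ≤ (2 * N + 1) * annealedPartFun N β ^ 2 := by
  unfold overlapWeightSum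
  rw [integral_finsetSum _ fun σ _ => integrable_finsetSum _ fun τ _ =>
    (integrable_exp_ham_add σ τ).const_mul _]
  calc _ ≤ ∑ σ : Config N, ∑ τ : Config N,
        annealedPartFun N β ^ 2 / 4 ^ N * exp (N * ovlp N σ τ ^ 2 / 2) := by
        refine Finset.sum_le_sum fun σ _ => ?_
        rw [integral_finsetSum _ fun τ _ => (integrable_exp_ham_add σ τ).const_mul _]
        refine Finset.sum_le_sum fun τ _ => ?_
        rw [integral_const_mul]
        refine (mul_le_mul_of_nonneg_left (integral_exp_ham_add_le hN σ τ)
          (exp_pos _).le).trans_eq ?_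
        rw [mul_left_comm, ← Real.exp_add]
        congr 2; ring
    _ = annealedPartFun N β ^ 2 / 4 ^ N *
        ∑ σ : Config N, ∑ τ : Config N, exp (N * ovlp N σ τ ^ 2 / 2) := by
        simp only [Finset.mul_sum]
    _ ≤ annealedPartFun N β ^ 2 / 4 ^ N * ((2 * N + 1) * 4 ^ N) := by
        gcongr
        exact sum_exp_overlap_sq_le hN
    _ = _ := by field_simp

end Annealed

/-! ### Lower tail of the partition function -/

section LowerTail

variable {N : ℕ} {β : ℝ}

theorem continuous_ham (σ : Config N) : Continuous fun g => ham N β g σ := by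
  unfold ham; fun_prop

theorem continuous_partFun : Continuous (partFun N β) := by
  unfold partFun
  exact continuous_finsetSum _ fun σ _ => (continuous_ham σ).rexp

theorem continuous_overlapWeightSum : Continuous (overlapWeightSum N β) := by
  unfold overlapWeightSum
  exact continuous_finsetSum _ fun σ _ => continuous_finsetSum _ fun τ _ =>
    continuous_const.mul ((continuous_ham σ).add (continuous_ham τ)).rexp

theorem partFun_sq (g : Fin N × Fin N → ℝ) :
    partFun N β g ^ 2 = ∑ σ : Config N, ∑ τ : Config N, exp (ham N β g σ + ham N β g τ) := by
  simp only [partFun, sq, Finset.sum_mul_sum, Real.exp_add]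

theorem partFun_sq_le (hβ : β ∈ Set.Ioo (0 : ℝ) 1) (g : Fin N × Fin N → ℝ) :
    partFun N β g ^ 2 ≤ overlapWeightSum N β g := by
  have hδ : 0 ≤ 1 - β ^ 2 := by nlinarith [hβ.1, hβ.2]
  rw [partFun_sq, overlapWeightSum]
  refine Finset.sum_le_sum fun σ _ => Finset.sum_le_sum fun τ _ => ?_
  exact le_mul_of_one_le_left (exp_pos _).le (one_le_exp (by positivity))

/-- Disorder for which the partition function and the overlap are both well behaved. -/
def goodDisorder (N : ℕ) (β : ℝ) : Set (Fin N × Fin N → ℝ) :=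
  {g | annealedPartFun N β / 2 ≤ partFun N β g ∧
    overlapWeightSum N β g ≤ (4 * (2 * N + 1) * annealedPartFun N β) ^ 2}

theorem measurableSet_goodDisorder : MeasurableSet (goodDisorder N β) :=
  (isClosed_le continuous_const continuous_partFun).measurableSet.inter
    (isClosed_le continuous_overlapWeightSum continuous_const).measurableSet

theorem le_measureReal_goodDisorder (hβ : β ∈ Set.Ioo (0 : ℝ) 1) (hN : 1 ≤ N) :
    1 / (16 * (2 * N + 1)) ≤ (gaussPi N).real (goodDisorder N β) := by
  set M := annealedPartFun N β with hM
  have hM0 : 0 < M := annealedPartFun_pos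
  set L : ℝ := 2 * N + 1 with hL
  have hL0 : 0 < L := by positivity
  have hpt : ∀ g, partFun N β g ≤ M / 2 + 1 / (4 * L * M) * overlapWeightSum N β g
      + (goodDisorder N β).indicator (fun _ => 4 * L * M) g := by
    intro g
    have hZ : 0 < partFun N β g := partFun_pos g
    have hZ2 := partFun_sq_le hβ g
    have hΦ : 0 ≤ overlapWeightSum N β g := (sq_nonneg _).trans hZ2
    have hΦ' : 0 ≤ 1 / (4 * L * M) * overlapWeightSum N β g := by positivity
    have hind : 0 ≤ (goodDisorder N β).indicator (fun _ => 4 * L * M) g :=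
      Set.indicator_nonneg (fun _ _ => by positivity) g
    by_cases h1 : M / 2 ≤ partFun N β g
    · by_cases h2 : overlapWeightSum N β g ≤ (4 * L * M) ^ 2
      · rw [Set.indicator_of_mem (show g ∈ goodDisorder N β from ⟨h1, h2⟩)]
        have : partFun N β g ≤ 4 * L * M :=
          le_of_sq_le_sq (hZ2.trans h2) (by positivity)
        linarith
      · push Not at h2
        have h3 : partFun N β g ≤ 1 / (4 * L * M) * overlapWeightSum N β g := by
          rw [one_div, ← div_eq_inv_mul, le_div_iff₀ (by positivity)]
          by_contra! h4
          have h5 : partFun N β g < 4 * L * M ∨ 4 * L * M ≤ partFun N β g := lt_or_ge _ _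
          rcases h5 with h5 | h5
          · nlinarith [mul_pos (mul_pos (show (0 : ℝ) < 4 by norm_num) hL0) hM0]
          · nlinarith
        linarith
    · push Not at h1
      linarith
  have hi1 : Integrable (fun g => 1 / (4 * L * M) * overlapWeightSum N β g) (gaussPi N) :=
    integrable_overlapWeightSum.const_mul _
  have hi2 : Integrable ((goodDisorder N β).indicator fun _ => 4 * L * M) (gaussPi N) :=
    (integrable_const _).indicator measurableSet_goodDisorder
  have hiZ : Integrable (partFun N β) (gaussPi N) :=
    integrable_finsetSum _ fun σ _ => integrable_exp_ham σ
  have hi01 : Integrable (fun g => M / 2 + 1 / (4 * L * M) * overlapWeightSum N β g) (gaussPi N) :=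
    (integrable_const (M / 2)).add hi1
  have h := integral_mono hiZ (hi01.add hi2) hpt
  have e : ∫ g, (M / 2 + 1 / (4 * L * M) * overlapWeightSum N β g
      + (goodDisorder N β).indicator (fun _ => 4 * L * M) g) ∂gaussPi N
      = M / 2 + 1 / (4 * L * M) * ∫ g, overlapWeightSum N β g ∂gaussPi N
        + (gaussPi N).real (goodDisorder N β) * (4 * L * M) := by
    rw [integral_add hi01 hi2, integral_add (integrable_const (M / 2)) hi1, integral_const_mul,
      integral_indicator_const _ measurableSet_goodDisorder]
    simp
  rw [integral_partFun hN] at h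
  have h' : M ≤ M / 2 + 1 / (4 * L * M) * ∫ g, overlapWeightSum N β g ∂gaussPi N
        + (gaussPi N).real (goodDisorder N β) * (4 * L * M) := h.trans_eq e
  have h2 : 1 / (4 * L * M) * ∫ g, overlapWeightSum N β g ∂gaussPi N ≤ M / 4 := by
    refine (mul_le_mul_of_nonneg_left (integral_overlapWeightSum_le hN) (by positivity)).trans_eq ?_
    rw [← hM, ← hL]
    field_simp
  have h3 : M / 4 ≤ (gaussPi N).real (goodDisorder N β) * (4 * L * M) := by linarith
  rw [div_le_iff₀ (by positivity)]
  by_contra! h4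
  nlinarith

/-- Bound on the squared gradient of the free energy over the good disorder. -/
def gradBound (N : ℕ) (β : ℝ) : ℝ := log (64 * (2 * N + 1) ^ 2) / (1 - β ^ 2)

theorem gradBound_pos (hβ : β ∈ Set.Ioo (0 : ℝ) 1) : 0 < gradBound N β := by
  have hδ : 0 < 1 - β ^ 2 := by nlinarith [hβ.1, hβ.2]
  refine div_pos (log_pos ?_) hδ
  have : (0 : ℝ) ≤ N := Nat.cast_nonneg N
  nlinarith

theorem gibbs2_ovlp_sq_le {g : Fin N × Fin N → ℝ}
    (hg : g ∈ goodDisorder N β) :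
    ∑ σ, gibbsWeight (ham N β g) σ * ∑ τ, gibbsWeight (ham N β g) τ *
      (N * (1 - β ^ 2) * ovlp N σ τ ^ 2 / 2) ≤ log (64 * (2 * N + 1) ^ 2) := by
  set w := gibbsWeight (ham N β g) with hw
  have hw0 : ∀ σ, 0 ≤ w σ := gibbsWeight_nonneg _
  have hw1 : ∑ σ, w σ = 1 := sum_gibbsWeight _
  have hM0 : 0 < annealedPartFun N β := annealedPartFun_pos
  rw [← Real.exp_le_exp, Real.exp_log (by positivity)]
  have hJ := convexOn_exp.map_sum_le (t := (univ : Finset (Config N × Config N)))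
    (w := fun p => w p.1 * w p.2) (p := fun p => N * (1 - β ^ 2) * ovlp N p.1 p.2 ^ 2 / 2)
    (fun p _ => mul_nonneg (hw0 _) (hw0 _))
    (by rw [Fintype.sum_prod_type]; simp only [← Finset.mul_sum, hw1, mul_one])
    (fun _ _ => Set.mem_univ _)
  simp only [smul_eq_mul, Fintype.sum_prod_type] at hJ
  have e1 : ∀ f : Config N → Config N → ℝ, ∑ σ, ∑ τ, w σ * w τ * f σ τ
      = ∑ σ, w σ * ∑ τ, w τ * f σ τ := by
    intro f
    simp only [Finset.mul_sum, mul_assoc]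
  rw [e1 fun σ τ => N * (1 - β ^ 2) * ovlp N σ τ ^ 2 / 2] at hJ
  refine hJ.trans ?_
  have e2 : ∑ σ, ∑ τ, w σ * w τ * exp (N * (1 - β ^ 2) * ovlp N σ τ ^ 2 / 2)
      = overlapWeightSum N β g / partFun N β g ^ 2 := by
    rw [overlapWeightSum, Finset.sum_div]
    refine Finset.sum_congr rfl fun σ _ => ?_
    rw [Finset.sum_div]
    refine Finset.sum_congr rfl fun τ _ => ?_
    have : ∀ σ, w σ = exp (ham N β g σ) / partFun N β g := fun σ => rfl
    rw [this, this, Real.exp_add]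
    ring
  rw [e2, div_le_iff₀ (by have := partFun_pos (β := β) g; positivity)]
  refine hg.2.trans ?_
  have h1 : (annealedPartFun N β / 2) ^ 2 ≤ partFun N β g ^ 2 :=
    pow_le_pow_left₀ (by positivity) hg.1 2
  have h2 : (0 : ℝ) ≤ 64 * (2 * N + 1) ^ 2 := by positivity
  nlinarith [mul_le_mul_of_nonneg_left h1 h2]

theorem sum_sq_gibbs_hamCoeff_le (hβ : β ∈ Set.Ioo (0 : ℝ) 1) (hN : 1 ≤ N)
    {g : Fin N × Fin N → ℝ} (hg : g ∈ goodDisorder N β) :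
    ∑ p, (∑ σ, gibbsWeight (ham N β g) σ * hamCoeff N β p σ) ^ 2 ≤ gradBound N β := by
  set w := gibbsWeight (ham N β g) with hw
  have hw0 : ∀ σ, 0 ≤ w σ := gibbsWeight_nonneg _
  have hδ : 0 < 1 - β ^ 2 := by nlinarith [hβ.1, hβ.2]
  have hb1 : β ^ 2 ≤ 1 := by linarith
  have h := gibbs2_ovlp_sq_le hg
  rw [← hw] at h
  have e : ∑ p, (∑ σ, w σ * hamCoeff N β p σ) ^ 2
      = ∑ σ, w σ * ∑ τ, w τ * (β ^ 2 / 2 * (N * ovlp N σ τ ^ 2 - 1)) := by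
    simp only [← sum_hamCoeff_mul hN]
    simp only [pow_two, Finset.sum_mul_sum]
    simp only [Finset.mul_sum]
    rw [Finset.sum_comm]
    refine Finset.sum_congr rfl fun σ _ => ?_
    rw [Finset.sum_comm]
    exact Finset.sum_congr rfl fun τ _ => Finset.sum_congr rfl fun p _ => by ring
  rw [e, gradBound, le_div_iff₀ hδ]
  refine le_trans ?_ h
  rw [Finset.sum_mul]
  refine Finset.sum_le_sum fun σ _ => ?_
  rw [mul_assoc]
  refine mul_le_mul_of_nonneg_left ?_ (hw0 σ)
  rw [Finset.sum_mul]
  refine Finset.sum_le_sum fun τ _ => ?_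
  rw [mul_assoc]
  refine mul_le_mul_of_nonneg_left ?_ (hw0 τ)
  have h0 : 0 ≤ N * ovlp N σ τ ^ 2 := by positivity
  have h1 : β ^ 2 / 2 * (N * ovlp N σ τ ^ 2 - 1) ≤ N * ovlp N σ τ ^ 2 / 2 := by
    nlinarith [sq_nonneg β]
  calc _ ≤ N * ovlp N σ τ ^ 2 / 2 * (1 - β ^ 2) := mul_le_mul_of_nonneg_right h1 hδ.le
    _ = _ := by ring

theorem le_partFun_of_goodDisorder (hβ : β ∈ Set.Ioo (0 : ℝ) 1) (hN : 1 ≤ N)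
    {g₀ : Fin N × Fin N → ℝ} (hg₀ : g₀ ∈ goodDisorder N β) (g : Fin N × Fin N → ℝ) :
    annealedPartFun N β / 2 * exp (-(√(gradBound N β) * √(∑ p, (g p - g₀ p) ^ 2)))
      ≤ partFun N β g := by
  set w := gibbsWeight (ham N β g₀) with hw
  have hw0 : ∀ σ, 0 ≤ w σ := gibbsWeight_nonneg _
  have hw1 : ∑ σ, w σ = 1 := sum_gibbsWeight _
  have hZ₀ : 0 < partFun N β g₀ := partFun_pos g₀
  have hJ := convexOn_exp.map_sum_le (t := (univ : Finset (Config N)))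
    (w := w) (p := fun σ => ham N β g σ - ham N β g₀ σ)
    (fun σ _ => hw0 σ) hw1 (fun _ _ => Set.mem_univ _)
  simp only [smul_eq_mul] at hJ
  have e1 : ∑ σ, w σ * exp (ham N β g σ - ham N β g₀ σ) = partFun N β g / partFun N β g₀ := by
    rw [partFun, Finset.sum_div]
    refine Finset.sum_congr rfl fun σ _ => ?_
    have : w σ = exp (ham N β g₀ σ) / partFun N β g₀ := rfl
    rw [this, Real.exp_sub]
    field_simp
  have e2 : ∑ σ, w σ * (ham N β g σ - ham N β g₀ σ)
      = ∑ p, (g p - g₀ p) * ∑ σ, w σ * hamCoeff N β p σ := by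
    simp only [ham_eq_sum, ← Finset.sum_sub_distrib, Finset.mul_sum]
    rw [Finset.sum_comm]
    exact Finset.sum_congr rfl fun p _ => Finset.sum_congr rfl fun σ _ => by ring
  rw [e1, e2, le_div_iff₀ hZ₀] at hJ
  have hCS := Finset.sum_mul_sq_le_sq_mul_sq univ (fun p => g p - g₀ p)
    fun p => ∑ σ, w σ * hamCoeff N β p σ
  have hgrad := sum_sq_gibbs_hamCoeff_le hβ hN hg₀
  rw [← hw] at hgrad
  have hlow : -(√(gradBound N β) * √(∑ p, (g p - g₀ p) ^ 2))
      ≤ ∑ p, (g p - g₀ p) * ∑ σ, w σ * hamCoeff N β p σ := by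
    refine (abs_le.1 ?_).1
    rw [← Real.sqrt_mul (gradBound_pos hβ).le]
    refine Real.abs_le_sqrt (hCS.trans ?_)
    rw [mul_comm]
    exact mul_le_mul_of_nonneg_right hgrad (Finset.sum_nonneg fun p _ => sq_nonneg _)
  calc _ ≤ partFun N β g₀ * exp (-(√(gradBound N β) * √(∑ p, (g p - g₀ p) ^ 2))) := by
        gcongr
        exact hg₀.1
    _ ≤ exp (∑ p, (g p - g₀ p) * ∑ σ, w σ * hamCoeff N β p σ) * partFun N β g₀ := by
        rw [mul_comm]
        gcongr
    _ ≤ _ := hJ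

end LowerTail

/-! ### Tail of the overlap -/

theorem measureReal_mul_measureReal_pi_le {ι : Type*} [Fintype ι] {A B : Set (ι → ℝ)}
    (hA : MeasurableSet A) (hne : A.Nonempty) {r : ℝ} (hr : 0 ≤ r)
    (hAB : ∀ x ∈ A, ∀ y ∈ B, r ≤ √(∑ p, (y p - x p) ^ 2)) :
    (Measure.pi fun _ : ι => gaussianReal 0 1).real A *
      (Measure.pi fun _ : ι => gaussianReal 0 1).real B ≤ exp (-(2 * r ^ 2 / π ^ 2)) := by
  set μ := Measure.pi fun _ : ι => gaussianReal 0 1 with hμ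
  set A' : Set (EuclideanSpace ℝ ι) := WithLp.ofLp ⁻¹' A with hA'
  have hmeas : Measurable (WithLp.toLp 2 : (ι → ℝ) → EuclideanSpace ℝ ι) := by fun_prop
  have hmeas' : Measurable (WithLp.ofLp : EuclideanSpace ℝ ι → ι → ℝ) := by fun_prop
  have hA'm : MeasurableSet A' := hmeas' hA
  have h := measure_mul_measure_infDist_stdGaussian_le hA'm hr
  rw [← map_pi_eq_stdGaussian, ← hμ, Measure.map_apply hmeas hA'm] at h
  have hB : μ B ≤ μ.map (WithLp.toLp 2) {y | r ≤ Metric.infDist y A'} := by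
    refine (measure_mono fun y hy => ?_).trans (Measure.le_map_apply hmeas.aemeasurable _)
    have hne' : A'.Nonempty := hne.elim fun x hx => ⟨WithLp.toLp 2 x, hx⟩
    refine (Metric.le_infDist hne').2 fun x hx => ?_
    rw [EuclideanSpace.dist_eq]
    simpa [Real.dist_eq, sq_abs] using hAB x.ofLp hx y hy
  have h2 : μ A * μ B ≤ ENNReal.ofReal (exp (-(2 * r ^ 2 / π ^ 2))) :=
    le_trans (mul_le_mul_right hB _) h
  rw [Measure.real, Measure.real, ← ENNReal.toReal_mul]
  exact ENNReal.toReal_le_of_le_ofReal (exp_pos _).le h2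

section OverlapTail

variable {N : ℕ} {β : ℝ}

theorem measureReal_partFun_lt_le (hβ : β ∈ Set.Ioo (0 : ℝ) 1) (hN : 1 ≤ N) {r : ℝ} (hr : 0 ≤ r) :
    (gaussPi N).real {g | partFun N β g < annealedPartFun N β / 2 * exp (-(√(gradBound N β) * r))}
      ≤ 16 * (2 * N + 1) * exp (-(2 * r ^ 2 / π ^ 2)) := by
  have hA := le_measureReal_goodDisorder hβ hN
  have hL : (0 : ℝ) < 16 * (2 * N + 1) := by positivity
  have hA0 : 0 < (gaussPi N).real (goodDisorder N β) := lt_of_lt_of_le (by positivity) hA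
  have hne : (goodDisorder N β).Nonempty := by
    rw [Set.nonempty_iff_ne_empty]
    intro h
    simp [h] at hA0
  have hM0 : 0 < annealedPartFun N β := annealedPartFun_pos
  have h : (gaussPi N).real (goodDisorder N β) * (gaussPi N).real
      {g | partFun N β g < annealedPartFun N β / 2 * exp (-(√(gradBound N β) * r))}
      ≤ exp (-(2 * r ^ 2 / π ^ 2)) := by
    refine measureReal_mul_measureReal_pi_le measurableSet_goodDisorder hne hr fun x hx y hy => ?_
    have h1 := (le_partFun_of_goodDisorder hβ hN hx y).trans_lt hy
    have h2 := exp_lt_exp.1 (lt_of_mul_lt_mul_left h1 (by positivity))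
    have h3 : √(gradBound N β) * r < √(gradBound N β) * √(∑ p, (y p - x p) ^ 2) := by linarith
    exact (lt_of_mul_lt_mul_left h3 (Real.sqrt_nonneg _)).le
  set b := (gaussPi N).real
      {g | partFun N β g < annealedPartFun N β / 2 * exp (-(√(gradBound N β) * r))} with hb
  have hb0 : 0 ≤ b := measureReal_nonneg
  have h4 : 1 / (16 * (2 * N + 1)) * b ≤ exp (-(2 * r ^ 2 / π ^ 2)) :=
    (mul_le_mul_of_nonneg_right hA hb0).trans h
  rwa [one_div, ← div_eq_inv_mul, div_le_iff₀' hL] at h4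

/-- Expected Gibbs mass of pairs with squared overlap above a threshold. -/
def overlapTail (N : ℕ) (β u : ℝ) : ℝ :=
  Egibbs2 N β fun σ τ => if u < ovlp N σ τ ^ 2 then 1 else 0

theorem overlapTail_nonneg (u : ℝ) : 0 ≤ overlapTail N β u :=
  Egibbs2_nonneg fun σ τ => by split_ifs <;> norm_num

theorem gibbs2_tail_le {u : ℝ} (hβ : β ∈ Set.Ioo (0 : ℝ) 1) (g : Fin N × Fin N → ℝ) :
    gibbs2 N β g (fun σ τ => if u < ovlp N σ τ ^ 2 then 1 else 0)
      ≤ exp (-(N * (1 - β ^ 2) * u / 2)) * overlapWeightSum N β g / partFun N β g ^ 2 := by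
  have hδ : 0 ≤ 1 - β ^ 2 := by nlinarith [hβ.1, hβ.2]
  have hZ := partFun_pos (β := β) g
  unfold gibbs2 overlapWeightSum
  refine div_le_div_of_nonneg_right ?_ (by positivity)
  rw [Finset.mul_sum]
  refine Finset.sum_le_sum fun σ _ => ?_
  rw [Finset.mul_sum]
  refine Finset.sum_le_sum fun τ _ => ?_
  rw [← mul_assoc]
  refine mul_le_mul_of_nonneg_right ?_ (exp_pos _).le
  rw [← Real.exp_add]
  beta_reduce
  split_ifs with h
  · refine one_le_exp ?_
    have : 0 ≤ N * (1 - β ^ 2) * (ovlp N σ τ ^ 2 - u) :=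
      mul_nonneg (by positivity) (sub_nonneg.2 h.le)
    linarith
  · exact (exp_pos _).le

theorem gibbs2_tail_le_one {u : ℝ} (g : Fin N × Fin N → ℝ) :
    gibbs2 N β g (fun σ τ => if u < ovlp N σ τ ^ 2 then 1 else 0) ≤ 1 := by
  have hZ := partFun_pos (β := β) g
  unfold gibbs2
  rw [div_le_one (by positivity), partFun_sq]
  refine Finset.sum_le_sum fun σ _ => Finset.sum_le_sum fun τ _ => ?_
  refine mul_le_of_le_one_left (exp_pos _).le ?_
  beta_reduce
  split_ifs <;> norm_num

theorem overlapTail_le (hβ : β ∈ Set.Ioo (0 : ℝ) 1) (hN : 1 ≤ N) {r : ℝ} (hr : 0 ≤ r) (u : ℝ) :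
    overlapTail N β u ≤ 16 * (2 * N + 1) * exp (-(2 * r ^ 2 / π ^ 2))
      + 4 * (2 * N + 1) * exp (2 * (√(gradBound N β) * r) - N * (1 - β ^ 2) * u / 2) := by
  set M := annealedPartFun N β with hM
  have hM0 : 0 < M := annealedPartFun_pos
  set y := √(gradBound N β) * r with hy
  set B : Set (Fin N × Fin N → ℝ) := {g | partFun N β g < M / 2 * exp (-y)} with hB
  have hBm : MeasurableSet B := (isOpen_lt continuous_partFun continuous_const).measurableSet
  set c : ℝ := 4 / M ^ 2 * exp (2 * y - N * (1 - β ^ 2) * u / 2) with hc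
  have hc0 : 0 < c := by positivity
  have hpt : ∀ g, gibbs2 N β g (fun σ τ => if u < ovlp N σ τ ^ 2 then 1 else 0)
      ≤ B.indicator (fun _ => (1 : ℝ)) g + c * overlapWeightSum N β g := by
    intro g
    have hΦ : 0 ≤ overlapWeightSum N β g := (sq_nonneg _).trans (partFun_sq_le hβ g)
    by_cases hg : g ∈ B
    · rw [Set.indicator_of_mem hg]
      have := gibbs2_tail_le_one (β := β) (u := u) g
      have : 0 ≤ c * overlapWeightSum N β g := by positivity
      linarith
    · rw [Set.indicator_of_notMem hg, zero_add]
      refine (gibbs2_tail_le hβ g).trans ?_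
      have hZ : M / 2 * exp (-y) ≤ partFun N β g := not_lt.1 hg
      have hZ2 : (M / 2 * exp (-y)) ^ 2 ≤ partFun N β g ^ 2 :=
        pow_le_pow_left₀ (by positivity) hZ 2
      calc _ ≤ exp (-(N * (1 - β ^ 2) * u / 2)) * overlapWeightSum N β g /
            (M / 2 * exp (-y)) ^ 2 := by gcongr
        _ = c * overlapWeightSum N β g := by
          have e1 : exp (2 * y - N * (1 - β ^ 2) * u / 2)
              = exp (-(N * (1 - β ^ 2) * u / 2)) / exp (-y) ^ 2 := by
            rw [← Real.exp_nat_mul, ← Real.exp_sub]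
            congr 1; push_cast; ring
          rw [hc, e1]
          field_simp
          ring
  have hi1 : Integrable (B.indicator fun _ => (1 : ℝ)) (gaussPi N) :=
    (integrable_const _).indicator hBm
  have hi2 : Integrable (fun g => c * overlapWeightSum N β g) (gaussPi N) :=
    integrable_overlapWeightSum.const_mul _
  have hnn : ∀ g, 0 ≤ gibbs2 N β g (fun σ τ => if u < ovlp N σ τ ^ 2 then 1 else 0) := by
    intro g
    unfold gibbs2
    refine div_nonneg (Finset.sum_nonneg fun σ _ => Finset.sum_nonneg fun τ _ =>
      mul_nonneg ?_ (exp_pos _).le) (sq_nonneg _)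
    beta_reduce
    split_ifs <;> norm_num
  have h := integral_mono_of_nonneg (Eventually.of_forall hnn) (hi1.add hi2)
    (Eventually.of_forall hpt)
  have e : ∫ g, (B.indicator (fun _ => (1 : ℝ)) + fun g => c * overlapWeightSum N β g) g ∂gaussPi N
      = (gaussPi N).real B + c * ∫ g, overlapWeightSum N β g ∂gaussPi N := by
    rw [integral_add' hi1 hi2, integral_const_mul, integral_indicator_const _ hBm]
    simp
  refine h.trans (e.trans_le (add_le_add (measureReal_partFun_lt_le hβ hN hr) ?_))
  refine (mul_le_mul_of_nonneg_left (integral_overlapWeightSum_le hN) hc0.le).trans_eq ?_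
  rw [hc, ← hM]
  field_simp

/-- The overlap tail at the scale `1 - β ^ 2`. -/
theorem overlapTail_scaled_le (hβ : β ∈ Set.Ioo (0 : ℝ) 1) (hN : 1 ≤ N) {ε : ℝ} (hε : 0 < ε) :
    overlapTail N β (ε * (1 - β ^ 2)) ≤ 16 * (2 * N + 1) *
        exp (-(ε ^ 2 / (32 * π ^ 2) *
          (N ^ 2 * (1 - β ^ 2) ^ 5 / log (64 * (2 * N + 1) ^ 2))))
      + 4 * (2 * N + 1) * exp (-(ε / 4 * (N * (1 - β ^ 2) ^ 2))) := by
  have hδ : 0 < 1 - β ^ 2 := by nlinarith [hβ.1, hβ.2]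
  have hK : 0 < gradBound N β := gradBound_pos hβ
  have hKs : 0 < √(gradBound N β) := Real.sqrt_pos.2 hK
  set r := ε * N * (1 - β ^ 2) ^ 2 / (8 * √(gradBound N β)) with hr
  have h := overlapTail_le hβ hN (r := r) (by positivity) (ε * (1 - β ^ 2))
  have e1 : 2 * (√(gradBound N β) * r) - N * (1 - β ^ 2) * (ε * (1 - β ^ 2)) / 2
      = -(ε / 4 * (N * (1 - β ^ 2) ^ 2)) := by
    rw [hr]; field_simp; ring
  have e2 : 2 * r ^ 2 / π ^ 2 = ε ^ 2 / (32 * π ^ 2) *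
      (N ^ 2 * (1 - β ^ 2) ^ 5 / log (64 * (2 * N + 1) ^ 2)) := by
    rw [hr, div_pow, mul_pow 8, Real.sq_sqrt hK.le, gradBound]
    have hl : log (64 * (2 * (N : ℝ) + 1) ^ 2) ≠ 0 := by
      intro h0; rw [gradBound, h0, zero_div] at hK; exact hK.false
    field_simp
    ring
  rwa [e1, e2] at h

end OverlapTail

/-! ### Uniform estimates -/

theorem pow_mul_mul_exp_neg_le {a b X n : ℝ} (ha : 0 < a) (hb : 0 < b) (hX : 0 ≤ X) (hn : 1 ≤ n)
    (h : a * n ≤ X ^ 6) (k : ℕ) :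
    n ^ k * ((2 * n + 1) * exp (-(b * X)))
      ≤ 3 * ((6 * (k + 1)).factorial / (b ^ (6 * (k + 1)) * a ^ (k + 1))) := by
  have h0 : 0 ≤ n := by linarith
  have h1 : n ^ k * (2 * n + 1) ≤ 3 * n ^ (k + 1) := by
    rw [pow_succ]
    nlinarith [pow_nonneg h0 k, mul_nonneg (pow_nonneg h0 k) (sub_nonneg.2 hn)]
  have h2 : a ^ (k + 1) * n ^ (k + 1) ≤ X ^ (6 * (k + 1)) := by
    rw [← mul_pow, pow_mul]
    exact pow_le_pow_left₀ (by positivity) h _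
  have h3 := Real.pow_div_factorial_le_exp (b * X) (by positivity) (6 * (k + 1))
  rw [div_le_iff₀ (by positivity), mul_pow] at h3
  have h4 : n ^ (k + 1) * exp (-(b * X))
      ≤ (6 * (k + 1)).factorial / (b ^ (6 * (k + 1)) * a ^ (k + 1)) := by
    rw [Real.exp_neg, ← div_eq_mul_inv, div_le_div_iff₀ (exp_pos _) (by positivity)]
    calc n ^ (k + 1) * (b ^ (6 * (k + 1)) * a ^ (k + 1))
        = b ^ (6 * (k + 1)) * (a ^ (k + 1) * n ^ (k + 1)) := by ring
      _ ≤ b ^ (6 * (k + 1)) * X ^ (6 * (k + 1)) := by gcongr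
      _ ≤ _ := by rw [mul_comm ((6 * (k + 1)).factorial : ℝ)]; exact h3
  calc _ = n ^ k * (2 * n + 1) * exp (-(b * X)) := by ring
    _ ≤ 3 * n ^ (k + 1) * exp (-(b * X)) := by gcongr
    _ = 3 * (n ^ (k + 1) * exp (-(b * X))) := by ring
    _ ≤ _ := by gcongr

theorem log_pow_six_le {n : ℝ} (hn : 1 ≤ n) :
    log (64 * (2 * n + 1) ^ 2) ^ 6 ≤ 525288 * n := by
  have hl : 0 ≤ log (64 * (2 * n + 1) ^ 2) := log_nonneg (by nlinarith)
  have h := Real.pow_div_factorial_le_exp _ hl 12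
  rw [Real.exp_log (by positivity), div_le_iff₀ (by positivity)] at h
  refine le_of_sq_le_sq ?_ (by positivity)
  rw [← pow_mul]
  refine h.trans ?_
  have hf : ((12 : ℕ).factorial : ℝ) = 479001600 := by norm_num [Nat.factorial]
  rw [hf]
  nlinarith

/-- The overlap tail decays faster than any power of `N` as long as `N (1 - β ^ 2) ^ 3` is bounded
away from zero. -/
theorem exists_pow_mul_overlapTail_le {c ε : ℝ} (hc : 0 < c) (hε : 0 < ε) (k : ℕ) :
    ∃ T : ℝ, ∀ (N : ℕ) (β : ℝ), 1 ≤ N → β ∈ Set.Ioo (0 : ℝ) 1 → c ≤ N * (1 - β ^ 2) ^ 3 →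
      (N : ℝ) ^ k * overlapTail N β (ε * (1 - β ^ 2)) ≤ T := by
  have hb : 0 < ε ^ 2 / (32 * π ^ 2) := by positivity
  have ha : 0 < c ^ 10 / 525288 := by positivity
  refine ⟨16 * (3 * ((6 * (k + 1)).factorial /
      ((ε ^ 2 / (32 * π ^ 2)) ^ (6 * (k + 1)) * (c ^ 10 / 525288) ^ (k + 1)))) +
    4 * (3 * ((6 * (k + 1)).factorial / ((ε / 4) ^ (6 * (k + 1)) * (c ^ 4) ^ (k + 1)))),
    fun N β hN hβ hcN => ?_⟩
  have hδ : 0 < 1 - β ^ 2 := by nlinarith [hβ.1, hβ.2]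
  have hn : (1 : ℝ) ≤ N := by exact_mod_cast hN
  have hl : 0 < log (64 * (2 * (N : ℝ) + 1) ^ 2) := log_pos (by nlinarith)
  set ℓ := log (64 * (2 * (N : ℝ) + 1) ^ 2) with hℓ
  have hX₁ : c ^ 10 / 525288 * N ≤ (N ^ 2 * (1 - β ^ 2) ^ 5 / ℓ) ^ 6 := by
    rw [div_pow, le_div_iff₀ (by positivity)]
    calc c ^ 10 / 525288 * N * ℓ ^ 6 ≤ c ^ 10 / 525288 * N * (525288 * N) := by
          gcongr; exact log_pow_six_le hn
      _ = c ^ 10 * N ^ 2 := by ring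
      _ ≤ (N * (1 - β ^ 2) ^ 3) ^ 10 * N ^ 2 := by gcongr
      _ = _ := by ring
  have hX₂ : c ^ 4 * N ≤ (N * (1 - β ^ 2) ^ 2) ^ 6 := by
    calc c ^ 4 * N ≤ c ^ 4 * N ^ 2 := by gcongr; nlinarith
      _ ≤ (N * (1 - β ^ 2) ^ 3) ^ 4 * N ^ 2 := by gcongr
      _ = _ := by ring
  calc _ ≤ (N : ℝ) ^ k * (16 * (2 * N + 1) *
          exp (-(ε ^ 2 / (32 * π ^ 2) * (N ^ 2 * (1 - β ^ 2) ^ 5 / ℓ)))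
        + 4 * (2 * N + 1) * exp (-(ε / 4 * (N * (1 - β ^ 2) ^ 2)))) := by
        gcongr; exact overlapTail_scaled_le hβ hN hε
    _ = 16 * ((N : ℝ) ^ k * ((2 * N + 1) *
          exp (-(ε ^ 2 / (32 * π ^ 2) * (N ^ 2 * (1 - β ^ 2) ^ 5 / ℓ)))))
        + 4 * ((N : ℝ) ^ k * ((2 * N + 1) * exp (-(ε / 4 * (N * (1 - β ^ 2) ^ 2))))) := by ring
    _ ≤ _ := by
        refine add_le_add (mul_le_mul_of_nonneg_left
          (pow_mul_mul_exp_neg_le ha hb (by positivity) hn hX₁ k) (by norm_num))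
          (mul_le_mul_of_nonneg_left (pow_mul_mul_exp_neg_le (pow_pos hc 4)
            (by positivity : 0 < ε / 4) (by positivity) hn hX₂ k) (by norm_num))

theorem overlapMoment_succ_le (N : ℕ) (β : ℝ) {u : ℝ} (hu : 0 ≤ u) (k : ℕ) :
    overlapMoment N β (k + 1) ≤ u * overlapMoment N β k + overlapTail N β u := by
  unfold overlapMoment overlapTail
  rw [← Egibbs2_const_mul, ← Egibbs2_add]
  refine Egibbs2_mono fun σ τ => ?_
  rw [pow_mul, pow_mul, pow_succ]
  set x := ovlp N σ τ ^ 2 with hx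
  have hx0 : 0 ≤ x := sq_nonneg _
  have hx1 : x ≤ 1 := (sq_le_one_iff_abs_le_one _).2 (abs_ovlp_le σ τ)
  have hk0 : 0 ≤ x ^ k := pow_nonneg hx0 k
  split_ifs with h
  · nlinarith [pow_le_one₀ hx0 hx1 (n := k), mul_nonneg hu hk0]
  · nlinarith

/-- Scaled overlap moments are bounded as long as `N (1 - β ^ 2) ^ 3` is bounded away from zero. -/
theorem exists_scaled_overlapMoment_le {c : ℝ} (hc : 0 < c) (k : ℕ) :
    ∃ T : ℝ, ∀ (N : ℕ) (β : ℝ), 1 ≤ N → β ∈ Set.Ioo (0 : ℝ) 1 → c ≤ N * (1 - β ^ 2) ^ 3 →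
      ((N : ℝ) * (1 - β ^ 2)) ^ k * overlapMoment N β k ≤ T := by
  induction k with
  | zero => exact ⟨1, fun N β _ _ _ => by rw [overlapMoment_zero]; norm_num⟩
  | succ j ih =>
    obtain ⟨T, hT⟩ := ih
    set C := CavitySystem.cavityConst j with hC
    have hC0 : 0 < C := by
      rw [hC, CavitySystem.cavityConst, CavitySystem.errConst]; positivity
    obtain ⟨S, hS⟩ := exists_pow_mul_overlapTail_le hc (by positivity : 0 < 1 / (2 * C)) (j + 1)
    refine ⟨4 * (2 * j + 1) * T + 2 * C * S, fun N β hN hβ hcN => ?_⟩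
    have hδ : 0 < 1 - β ^ 2 := by nlinarith [hβ.1, hβ.2]
    have hδ1 : 1 - β ^ 2 ≤ 1 := by nlinarith [sq_nonneg β]
    have hN0 : (0 : ℝ) < N := by exact_mod_cast hN
    specialize hT N β hN hβ hcN
    specialize hS N β hN hβ hcN
    have hrec := overlapMoment_recursion hβ hN j
    have hsucc := overlapMoment_succ_le N β
      (by positivity : 0 ≤ 1 / (2 * C) * (1 - β ^ 2)) (j + 1)
    have htail := overlapTail_nonneg (N := N) (β := β) (1 / (2 * C) * (1 - β ^ 2))
    set δ := 1 - β ^ 2 with hδdef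
    set τ := overlapTail N β (1 / (2 * C) * δ) with hτ
    clear_value δ
    have h1 : δ * overlapMoment N β (j + 1)
        ≤ 4 * (2 * j + 1) / N * overlapMoment N β j + 2 * C * τ := by
      have h2 := mul_le_mul_of_nonneg_left hsucc hC0.le
      have h3 : C * (1 / (2 * C) * δ * overlapMoment N β (j + 1) + τ)
          = δ / 2 * overlapMoment N β (j + 1) + C * τ := by field_simp
      have h4 : 4 * (2 * j + 1) / N * overlapMoment N β j
          = 2 * (2 * (2 * j + 1) / N * overlapMoment N β j) := by ring
      linarith
    have h5 : ((N : ℝ) * δ) ^ (j + 1) * overlapMoment N β (j + 1)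
        = N * ((N : ℝ) * δ) ^ j * (δ * overlapMoment N β (j + 1)) := by ring
    have h6 : N * ((N : ℝ) * δ) ^ j * (4 * (2 * j + 1) / N * overlapMoment N β j + 2 * C * τ)
        = 4 * (2 * j + 1) * (((N : ℝ) * δ) ^ j * overlapMoment N β j)
          + 2 * C * (δ ^ j * (N ^ (j + 1) * τ)) := by
      have hcancel : (N : ℝ) * (4 * (2 * j + 1) / N) = 4 * (2 * j + 1) := by field_simp
      linear_combination ((N : ℝ) * δ) ^ j * overlapMoment N β j * hcancel
    have h7 : δ ^ j * (N ^ (j + 1) * τ) ≤ N ^ (j + 1) * τ :=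
      mul_le_of_le_one_left (by positivity) (pow_le_one₀ hδ.le hδ1)
    calc _ = _ := h5
      _ ≤ _ := mul_le_mul_of_nonneg_left h1 (by positivity)
      _ = _ := h6
      _ ≤ _ := by gcongr; exact h7.trans hS

theorem exists_pos_forall_le_of_eventually {f : ℕ → ℝ} (hf : ∀ n, 1 ≤ n → 0 < f n) {c : ℝ}
    (hc : 0 < c) (h : ∀ᶠ n in atTop, c ≤ f n) : ∃ c', 0 < c' ∧ ∀ n, 1 ≤ n → c' ≤ f n := by
  obtain ⟨m, hm⟩ := eventually_atTop.1 h
  rcases (Finset.Icc 1 m).eq_empty_or_nonempty with h0 | h0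
  · refine ⟨c, hc, fun n hn => hm n ?_⟩
    rw [Finset.Icc_eq_empty_iff] at h0
    omega
  · obtain ⟨i, hi, hmin⟩ := Finset.exists_min_image _ f h0
    refine ⟨min c (f i), lt_min hc (hf i (Finset.mem_Icc.1 hi).1), fun n hn => ?_⟩
    rcases le_total n m with h1 | h1
    · exact (min_le_right _ _).trans (hmin n (Finset.mem_Icc.2 ⟨hn, h1⟩))
    · exact (min_le_left _ _).trans (hm n h1)

/-- Talagrand's overlap moment bounds near the critical temperature:
for each `k ≥ 1`, `sup_N E⟨(N(1−β_N²)R(σ¹,σ²)²)^k⟩ < ∞`. -/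
theorem sk_overlap_moment_bounds
    (β : ℕ → ℝ) (hβmem : ∀ N, β N ∈ Set.Ioo (0 : ℝ) 1)
    (hβlim : Tendsto β atTop (nhds 1))
    (hc : (∃ c : ℝ, 0 < c ∧
        Tendsto (fun N : ℕ => (N : ℝ) ^ ((1 : ℝ) / 3) * (1 - β N ^ 2)) atTop (nhds c)) ∨
      Tendsto (fun N : ℕ => (N : ℝ) ^ ((1 : ℝ) / 3) * (1 - β N ^ 2)) atTop atTop) :
    ∀ k : ℕ, 1 ≤ k → ∃ M : ℝ, ∀ N : ℕ, 1 ≤ N →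
      Egibbs2 N (β N)
        (fun σ τ => ((N : ℝ) * (1 - β N ^ 2) * ovlp N σ τ ^ 2) ^ k) ≤ M := by


  have hδ : ∀ N, 0 < 1 - β N ^ 2 := fun N => by nlinarith [(hβmem N).1, (hβmem N).2]
  have hev : ∃ c : ℝ, 0 < c ∧ ∀ᶠ N : ℕ in atTop,
      c ≤ (N : ℝ) ^ ((1 : ℝ) / 3) * (1 - β N ^ 2) := by
    rcases hc with ⟨c, hc0, hlim⟩ | hlim
    · exact ⟨c / 2, half_pos hc0, hlim.eventually_const_le (half_lt_self hc0)⟩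
    · exact ⟨1, one_pos, hlim.eventually_ge_atTop 1⟩
  obtain ⟨c, hc0, hev⟩ := hev
  have hcube : ∀ᶠ N : ℕ in atTop, c ^ 3 ≤ N * (1 - β N ^ 2) ^ 3 := by
    filter_upwards [hev] with N hN
    have h := pow_le_pow_left₀ hc0.le hN 3
    rwa [mul_pow, ← Real.rpow_natCast, ← Real.rpow_natCast ((N : ℝ) ^ _), ← Real.rpow_mul
      (Nat.cast_nonneg N), Real.rpow_natCast, show (1 : ℝ) / 3 * (3 : ℕ) = 1 by norm_num,
      Real.rpow_one] at h
  obtain ⟨c', hc', hall⟩ := exists_pos_forall_le_of_eventually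
    (f := fun N : ℕ => (N : ℝ) * (1 - β N ^ 2) ^ 3)
    (fun N hN => mul_pos (by exact_mod_cast hN) (pow_pos (hδ N) 3)) (pow_pos hc0 3) hcube
  intro k _
  obtain ⟨M, hM⟩ := exists_scaled_overlapMoment_le hc' k
  refine ⟨M, fun N hN => ?_⟩
  refine le_of_eq_of_le ?_ (hM N (β N) hN (hβmem N) (hall N hN))
  rw [overlapMoment, ← Egibbs2_const_mul]
  simp only [mul_pow, pow_mul]

end
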